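/- Let P be a non-simple finite dimensional indecomposable projective left H_{mn}(ξ)-module. Then rad P = soc² P and rad² P = soc P, where rad P = J·P for J the Jacobson radical of H_{mn}(ξ), soc P is the socle of P (the sum of all simple submodules), and soc² P is the preimage in P of soc(P/soc P). -/

import Mathlib

noncomputable section

namespace Radford

variable (𝕜 : Type) [Field 𝕜]

/-- The q-integer `(k)_q = 1 + q + ⋯ + q^(k-1)`. -/
def qInt (q : 𝕜) (k : ℕ) : 𝕜 := ∑ j ∈ Finset.range k, q ^ j

/-- The q-factorial `(k)!_q = (1)_q (2)_q ⋯ (k)_q`. -/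
def qFact (q : 𝕜) : ℕ → 𝕜
  | 0 => 1
  | k + 1 => qFact q k * qInt 𝕜 q (k + 1)

variable (m n : ℕ) (ξ : 𝕜)

/-- Generators of the free algebra: 0 ↦ a, 1 ↦ b, 2 ↦ c, 3 ↦ d. -/
def fgen (k : Fin 4) : FreeAlgebra 𝕜 (Fin 4) := FreeAlgebra.ι 𝕜 k

local notation "fa" => fgen 𝕜 0
local notation "fb" => fgen 𝕜 1
local notation "fc" => fgen 𝕜 2
local notation "fd" => fgen 𝕜 3

/-- The defining relations of the Drinfeld double `H_{mn}(ξ) = D(R_{mn}(q))`, where `q = ξ^m`. -/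
inductive HRel : FreeAlgebra 𝕜 (Fin 4) → FreeAlgebra 𝕜 (Fin 4) → Prop
  | aPow : HRel (fa ^ n) (fb ^ n - 1)
  | bPow : HRel (fb ^ (m * n)) 1
  | cPow : HRel (fc ^ (m * n)) 1
  | dPow : HRel (fd ^ n) 0
  | ab : HRel (fa * fb) (ξ ^ m • (fb * fa))
  | dc : HRel (fd * fc) (ξ • (fc * fd))
  | bc : HRel (fb * fc) (fc * fb)
  | bd : HRel (fb * fd) (ξ ^ m • (fd * fb))
  | ad : HRel (fa * fd - fd * fa) (fb - fc ^ m)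
  | ac : HRel (fa * fc)
      (ξ⁻¹ • (fc * fa) +
        ((ξ⁻¹ - ξ ^ (n - 1)) / qFact 𝕜 (ξ ^ m) (n - 1)) •
          ((fc ^ (m + 1) - ξ ^ m • (fb * fc)) * fd ^ (n - 1)))

/-- The Drinfeld double `H_{mn}(ξ)` of the Radford Hopf algebra `R_{mn}(q)`, presented by
generators `a, b, c, d` and the above relations. -/
def H := RingQuot (HRel 𝕜 m n ξ)

instance : Ring (H 𝕜 m n ξ) := inferInstanceAs (Ring (RingQuot (HRel 𝕜 m n ξ)))

instance : Algebra 𝕜 (H 𝕜 m n ξ) := inferInstanceAs (Algebra 𝕜 (RingQuot (HRel 𝕜 m n ξ)))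

/-- The generators `a, b, c, d` of `H_{mn}(ξ)` (indexed by 0,1,2,3). -/
def gen (k : Fin 4) : H 𝕜 m n ξ := RingQuot.mkAlgHom 𝕜 (HRel 𝕜 m n ξ) (fgen 𝕜 k)

local notation "ha" => gen 𝕜 m n ξ 0
local notation "hb" => gen 𝕜 m n ξ 1
local notation "hc" => gen 𝕜 m n ξ 2
local notation "hd" => gen 𝕜 m n ξ 3

/-- The Jacobson radical `J` of `H_{mn}(ξ)`. -/
def jrad : Ideal (H 𝕜 m n ξ) := Ideal.jacobson ⊥

/-- The scalars `α_k(l,i)`;  `alph l i k` is `α_k(l,i)`, where `q = ξ^m`. -/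
def alph (l : ℕ) (i : ℤ) (k : ℕ) : 𝕜 :=
  if k = n then ((ξ ^ m) ^ (i + (l : ℤ)) - (ξ ^ m) ^ i) / qFact 𝕜 (ξ ^ m) (n - 1)
  else qInt 𝕜 (ξ ^ m) k * ((ξ ^ m) ^ i - (ξ ^ m) ^ (i + (l : ℤ) - (k : ℤ)))

/-- The scalars `γ_k(l,i)`;  `gam l i k` is `γ_k(l,i)`, where `q = ξ^m`. -/
def gam (l : ℕ) (i : ℤ) (k : ℕ) : 𝕜 :=
  if k = n then ((ξ ^ m) ^ i - (ξ ^ m) ^ (i + (l : ℤ))) / qFact 𝕜 (ξ ^ m) (n - 1)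
  else qInt 𝕜 (ξ ^ m) k * ((ξ ^ m) ^ (i + (l : ℤ)) - (ξ ^ m) ^ (i - (k : ℤ)))

section ModuleH

variable {W : Type} [AddCommGroup W] [Module (H 𝕜 m n ξ) W]

variable (W) in
/-- The socle of an `H`-module: the sum of all simple submodules. -/
def socle : Submodule (H 𝕜 m n ξ) W :=
  sSup {N : Submodule (H 𝕜 m n ξ) W | IsSimpleModule (H 𝕜 m n ξ) N}

variable (W) in
/-- The submodule `J•W`, the radical of `W`. -/
def radM : Submodule (H 𝕜 m n ξ) W :=
  Submodule.span (H 𝕜 m n ξ) {x | ∃ r ∈ jrad 𝕜 m n ξ, ∃ w : W, x = r • w}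

variable (W) in
/-- The submodule `J²•W`. -/
def rad2M : Submodule (H 𝕜 m n ξ) W :=
  Submodule.span (H 𝕜 m n ξ)
    {x | ∃ r ∈ jrad 𝕜 m n ξ, ∃ s ∈ jrad 𝕜 m n ξ, ∃ w : W, x = r • s • w}

variable (W) in
/-- The submodule `J³•W`. -/
def rad3M : Submodule (H 𝕜 m n ξ) W :=
  Submodule.span (H 𝕜 m n ξ)
    {x | ∃ r ∈ jrad 𝕜 m n ξ, ∃ s ∈ jrad 𝕜 m n ξ, ∃ t ∈ jrad 𝕜 m n ξ, ∃ w : W, x = r • s • t • w}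

variable (W) in
/-- `lengthIs c W` : the `H`-module `W` has a composition series of length `c`
(hence, by Jordan–Hölder, has composition length `c`). -/
def lengthIs (c : ℕ) : Prop :=
  ∃ s : CompositionSeries (Submodule (H 𝕜 m n ξ) W), s.head = ⊥ ∧ s.last = ⊤ ∧ s.length = c

variable (W) in
/-- An `H`-module is indecomposable if it is nonzero and is not the direct sum of two
nonzero submodules. -/
def Indec : Prop :=
  Nontrivial W ∧ ∀ N₁ N₂ : Submodule (H 𝕜 m n ξ) W, IsCompl N₁ N₂ → N₁ = ⊥ ∨ N₂ = ⊥

variable (W) in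
/-- `W` has Loewy length 2: `J•W ≠ 0` and `J²•W = 0`. -/
def LoewyLen2 : Prop := radM 𝕜 m n ξ W ≠ ⊥ ∧ rad2M 𝕜 m n ξ W = ⊥

variable (W) in
/-- `W` is of `(s,t)`-type: it has Loewy length `2`, its socle has composition length `t`,
and `W/soc W` has composition length `s`. -/
def IsType (s t : ℕ) : Prop :=
  LoewyLen2 𝕜 m n ξ W ∧ lengthIs 𝕜 m n ξ (socle 𝕜 m n ξ W) t ∧
    lengthIs 𝕜 m n ξ (W ⧸ socle 𝕜 m n ξ W) s

end ModuleH

section ModuleK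

variable {V : Type} [AddCommGroup V] [Module 𝕜 V] [Module (H 𝕜 m n ξ) V]
  [IsScalarTower 𝕜 (H 𝕜 m n ξ) V]

variable (V) in
/-- `V^d = {v ∈ V | d•v = 0}`, as a `𝕜`-subspace. -/
def dKer : Submodule 𝕜 V where
  carrier := {v | hd • v = 0}
  add_mem' := by
    intro x y hx hy
    simp only [Set.mem_setOf_eq] at *
    rw [smul_add, hx, hy, add_zero]
  zero_mem' := smul_zero _
  smul_mem' := by
    intro r v hv
    simp only [Set.mem_setOf_eq] at *
    rw [smul_comm, hv, smul_zero]

variable (V) in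
/-- `V_{(i)} = {v ∈ V | c•v = ξ^i v}`, as a `𝕜`-subspace. -/
def eigsp (i : ℤ) : Submodule 𝕜 V where
  carrier := {v | hc • v = ξ ^ i • v}
  add_mem' := by
    intro x y hx hy
    simp only [Set.mem_setOf_eq] at *
    rw [smul_add, hx, hy, smul_add]
  zero_mem' := by simp
  smul_mem' := by
    intro r v hv
    simp only [Set.mem_setOf_eq] at *
    rw [smul_comm, hv, smul_comm]

/-- `V`, equipped with the family `mv : Fin l → V`, realizes the simple module `M(l,i)`:
`mv` is a basis of `V` and the generators act by the defining formulas of `M(l,i)`. -/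
def IsMrep (l : ℕ) (i : ℤ) (mv : Fin l → V) : Prop :=
  LinearIndependent 𝕜 mv ∧ Submodule.span 𝕜 (Set.range mv) = ⊤ ∧
  (∀ (j : ℕ) (hj : j + 1 < l),
    ha • mv ⟨j, by omega⟩ = alph 𝕜 m n ξ l i (j + 1) • mv ⟨j + 1, hj⟩) ∧
  (∀ (j : ℕ) (hj : j < l), j + 1 = l → ha • mv ⟨j, hj⟩ = 0) ∧
  (∀ j : Fin l, hb • mv j = ((ξ ^ m) ^ (i + (l : ℤ) - ((j : ℕ) + 1 : ℤ)) : 𝕜) • mv j) ∧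
  (∀ j : Fin l, hc • mv j = (ξ ^ (i + (j : ℕ) : ℤ) : 𝕜) • mv j) ∧
  (∀ (j : ℕ) (hj : j + 1 < l), hd • mv ⟨j + 1, hj⟩ = mv ⟨j, by omega⟩) ∧
  (∀ hl : 0 < l, hd • mv ⟨0, hl⟩ = 0)

/-- `V` realizes the induced module `Z(λ_{ij})`: there is a cyclic vector `z` with
`d•z = 0`, `b•z = ξ^j z`, `c•z = ξ^i z` such that `(a^k • z)_{0 ≤ k ≤ n-1}` is a basis. -/
def IsZrep (i j : ℤ) (V : Type) [AddCommGroup V] [Module 𝕜 V] [Module (H 𝕜 m n ξ) V]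
    [IsScalarTower 𝕜 (H 𝕜 m n ξ) V] : Prop :=
  ∃ z : V, hd • z = 0 ∧ hb • z = (ξ ^ j : 𝕜) • z ∧ hc • z = (ξ ^ i : 𝕜) • z ∧
    LinearIndependent 𝕜 (fun k : Fin n => (ha ^ (k : ℕ)) • z) ∧
    Submodule.span 𝕜 (Set.range fun k : Fin n => (ha ^ (k : ℕ)) • z) = ⊤

/-- `V`, equipped with the families `v u : Fin n → V`, realizes the projective module `P(l,i)`
with its standard basis. -/
def IsPrep (l : ℕ) (hl1 : 1 ≤ l) (hl2 : l < n) (i : ℤ) (v u : Fin n → V) : Prop :=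
  LinearIndependent 𝕜 (Sum.elim v u) ∧
  Submodule.span 𝕜 (Set.range v ∪ Set.range u) = ⊤ ∧
  (∀ (j : ℕ) (hj : j + l + 2 ≤ n),
    ha • v ⟨j, by omega⟩ = gam 𝕜 m n ξ l i (j + 1) • v ⟨j + 1, by omega⟩) ∧
  (∀ (j : ℕ) (hj : j + 1 < n), n ≤ j + 1 + l →
    ha • v ⟨j, by omega⟩ =
      gam 𝕜 m n ξ l i (j + 1) • v ⟨j + 1, hj⟩ + u ⟨j + 1 + l - n, by omega⟩) ∧
  (ha • v ⟨n - 1, by omega⟩ = gam 𝕜 m n ξ l i n • v ⟨0, by omega⟩ + u ⟨l, by omega⟩) ∧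
  (∀ (j : ℕ) (hj : j + 1 < n),
    ha • u ⟨j, by omega⟩ = alph 𝕜 m n ξ l i (j + 1) • u ⟨j + 1, hj⟩) ∧
  (ha • u ⟨n - 1, by omega⟩ = alph 𝕜 m n ξ l i n • u ⟨0, by omega⟩) ∧
  (∀ j : Fin n, hb • v j = ((ξ ^ m) ^ (i + (n : ℤ) - ((j : ℕ) + 1 : ℤ)) : 𝕜) • v j) ∧
  (∀ j : Fin n, hb • u j = ((ξ ^ m) ^ (i + (l : ℤ) - ((j : ℕ) + 1 : ℤ)) : 𝕜) • u j) ∧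
  (∀ j : Fin n, hc • v j = (ξ ^ (i - ((n : ℤ) - (l : ℤ)) + (j : ℕ) : ℤ) : 𝕜) • v j) ∧
  (∀ j : Fin n, hc • u j = (ξ ^ (i + (j : ℕ) : ℤ) : 𝕜) • u j) ∧
  (hd • v ⟨0, by omega⟩ = 0) ∧
  (∀ (j : ℕ) (hj : j + 1 < n), hd • v ⟨j + 1, hj⟩ = v ⟨j, by omega⟩) ∧
  (hd • u ⟨0, by omega⟩ = 0) ∧
  (∀ (j : ℕ) (hj : j + 1 < n), hd • u ⟨j + 1, hj⟩ = u ⟨j, by omega⟩)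

/-- `V`, equipped with the basis `e : Fin n → V`, realizes the module `T_1(l,i)`. -/
def IsT1rep (l : ℕ) (hl1 : 1 ≤ l) (hl2 : l < n) (i : ℤ) (e : Fin n → V) : Prop :=
  LinearIndependent 𝕜 e ∧ Submodule.span 𝕜 (Set.range e) = ⊤ ∧
  (∀ (j : ℕ) (hj : j + 1 < n),
    ha • e ⟨j, by omega⟩ = alph 𝕜 m n ξ l i (j + 1) • e ⟨j + 1, hj⟩) ∧
  (ha • e ⟨n - 1, by omega⟩ = alph 𝕜 m n ξ l i n • e ⟨0, by omega⟩) ∧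
  (∀ j : Fin n, hb • e j = ((ξ ^ m) ^ (i + (l : ℤ) - ((j : ℕ) + 1 : ℤ)) : 𝕜) • e j) ∧
  (∀ j : Fin n, hc • e j = (ξ ^ (i + (j : ℕ) : ℤ) : 𝕜) • e j) ∧
  (hd • e ⟨0, by omega⟩ = 0) ∧
  (∀ (j : ℕ) (hj : j + 1 < n), hd • e ⟨j + 1, hj⟩ = e ⟨j, by omega⟩)

/-- `V`, equipped with the basis `e : Fin n → V`, realizes the module `T̄_1(l,i)`. -/
def IsT1barrep (l : ℕ) (hl1 : 1 ≤ l) (hl2 : l < n) (i : ℤ) (e : Fin n → V) : Prop :=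
  LinearIndependent 𝕜 e ∧ Submodule.span 𝕜 (Set.range e) = ⊤ ∧
  (∀ (j : ℕ) (hj : j + 1 < n - l),
    ha • e ⟨j, by omega⟩ = alph 𝕜 m n ξ (n - l) (i + l - n) (j + 1) • e ⟨j + 1, by omega⟩) ∧
  (ha • e ⟨n - l - 1, by omega⟩ = e ⟨n - l, by omega⟩) ∧
  (∀ (k : ℕ) (hk : k + 1 < l),
    ha • e ⟨n - l + k, by omega⟩ = alph 𝕜 m n ξ l i (k + 1) • e ⟨n - l + k + 1, by omega⟩) ∧
  (ha • e ⟨n - 1, by omega⟩ = 0) ∧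
  (∀ j : Fin n, hb • e j = ((ξ ^ m) ^ (i - ((j : ℕ) + 1 : ℤ)) : 𝕜) • e j) ∧
  (∀ j : Fin n, hc • e j = (ξ ^ (i + (l : ℤ) - (n : ℤ) + (j : ℕ) : ℤ) : 𝕜) • e j) ∧
  (hd • e ⟨0, by omega⟩ = 0) ∧
  (∀ (j : ℕ) (hj : j + 1 < n - l), hd • e ⟨j + 1, by omega⟩ = e ⟨j, by omega⟩) ∧
  (hd • e ⟨n - l, by omega⟩ = 0) ∧
  (∀ (k : ℕ) (hk : k + 1 < l), hd • e ⟨n - l + k + 1, by omega⟩ = e ⟨n - l + k, by omega⟩)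

end ModuleK

section Matrices

/-- The nilpotent Jordan-type matrix `D_s` with `1` on the superdiagonal. -/
def Dmat (s : ℕ) : Matrix (Fin s) (Fin s) 𝕜 :=
  fun r c => if (r : ℕ) + 1 = (c : ℕ) then 1 else 0

/-- The matrix `X_{l,i}` : subdiagonal entries `γ_k(l,i)`, `(1,n)`-entry `γ_n(l,i)`. -/
def Xmat (l : ℕ) (i : ℤ) : Matrix (Fin n) (Fin n) 𝕜 := fun r c =>
  if (r : ℕ) = (c : ℕ) + 1 then gam 𝕜 m n ξ l i ((c : ℕ) + 1)
  else if (r : ℕ) = 0 ∧ (c : ℕ) = n - 1 then gam 𝕜 m n ξ l i n else 0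

/-- The matrix `Z_{l,i}` : subdiagonal entries `α_k(l,i)`, `(1,n)`-entry `α_n(l,i)`. -/
def Zmat (l : ℕ) (i : ℤ) : Matrix (Fin n) (Fin n) 𝕜 := fun r c =>
  if (r : ℕ) = (c : ℕ) + 1 then alph 𝕜 m n ξ l i ((c : ℕ) + 1)
  else if (r : ℕ) = 0 ∧ (c : ℕ) = n - 1 then alph 𝕜 m n ξ l i n else 0

/-- The block matrix `A(l,i) = [[X_{l,i}, 0], [D_n^{n-l-1}, Z_{l,i}]]`. -/
def Amat (l : ℕ) (i : ℤ) : Matrix (Fin n ⊕ Fin n) (Fin n ⊕ Fin n) 𝕜 :=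
  Matrix.fromBlocks (Xmat 𝕜 m n ξ l i) 0 (Dmat 𝕜 n ^ (n - l - 1)) (Zmat 𝕜 m n ξ l i)

/-- The diagonal matrix `B(l,i)`. -/
def Bmat (l : ℕ) (i : ℤ) : Matrix (Fin n ⊕ Fin n) (Fin n ⊕ Fin n) 𝕜 :=
  Matrix.fromBlocks
    (Matrix.diagonal fun j : Fin n => (ξ ^ m) ^ (i - ((j : ℕ) + 1 : ℤ))) 0 0
    (Matrix.diagonal fun j : Fin n => (ξ ^ m) ^ (i + (l : ℤ) - ((j : ℕ) + 1 : ℤ)))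

/-- The diagonal matrix `C(l,i)`. -/
def Cmat (l : ℕ) (i : ℤ) : Matrix (Fin n ⊕ Fin n) (Fin n ⊕ Fin n) 𝕜 :=
  Matrix.fromBlocks
    (Matrix.diagonal fun j : Fin n => ξ ^ (i + (l : ℤ) - (n : ℤ) + (j : ℕ))) 0 0
    (Matrix.diagonal fun j : Fin n => ξ ^ (i + (j : ℕ) : ℤ))

/-- The block matrix `D = diag(D_n, D_n)`. -/
def Dbig : Matrix (Fin n ⊕ Fin n) (Fin n ⊕ Fin n) 𝕜 :=
  Matrix.fromBlocks (Dmat 𝕜 n) 0 0 (Dmat 𝕜 n)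

end Matrices

section Lattice

/-- A lattice with a unique coatom `N₁`, a unique atom `N₂`, and two covers `A`, `B` of `N₂` with
join `N₁`: for submodule lattices, a module with simple top, simple socle and semisimple heart. -/
structure IsDiamond {L : Type*} [Lattice L] [BoundedOrder L] (N₁ N₂ A B : L) : Prop where
  le_of_ne_top : ∀ N : L, N ≠ ⊤ → N ≤ N₁
  ge_of_ne_bot : ∀ N : L, N ≠ ⊥ → N₂ ≤ N
  covA : N₂ ⋖ A
  covB : N₂ ⋖ B
  sup_eq : A ⊔ B = N₁
  ne_top : N₁ ≠ ⊤
  ne_bot : N₂ ≠ ⊥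

theorem IsDiamond.map {L L' : Type*} [Lattice L] [BoundedOrder L] [Lattice L'] [BoundedOrder L']
    {N₁ N₂ A B : L} (h : IsDiamond N₁ N₂ A B) (e : L ≃o L') :
    IsDiamond (e N₁) (e N₂) (e A) (e B) where
  le_of_ne_top N hN := by
    rw [← e.symm_apply_le]
    exact h.le_of_ne_top _ (by simpa using hN)
  ge_of_ne_bot N hN := by
    rw [← e.le_symm_apply]
    exact h.ge_of_ne_bot _ (by simpa using hN)
  covA := (apply_covBy_apply_iff e).2 h.covA
  covB := (apply_covBy_apply_iff e).2 h.covB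
  sup_eq := by rw [← h.sup_eq, map_sup]
  ne_top := by simpa using h.ne_top
  ne_bot := by simpa using h.ne_bot

variable {R M : Type*} [Ring R] [AddCommGroup M] [Module R M]

theorem isSemisimpleModule_of_jacobson_le_annihilator [IsArtinianRing R]
    (h : Ring.jacobson R ≤ Module.annihilator R M) : IsSemisimpleModule R M := by
  rw [← SetLike.coe_subset_coe, ← Module.isTorsionBySet_iff_subset_annihilator] at h
  let _ := h.module
  exact (h.semilinearMap.isSemisimpleModule_iff_of_bijective Function.bijective_id).2
    inferInstance

theorem jacobson_smul_le_of_covBy {N A : Submodule R M} (h : N ⋖ A) :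
    Ring.jacobson R • A ≤ N := by
  have := (covBy_iff_quot_is_simple h.le).1 h
  refine Submodule.smul_le.2 fun r hr x hx => ?_
  have h1 := Module.mem_annihilator.1 (IsSemisimpleModule.jacobson_le_annihilator R
    (A ⧸ N.comap A.subtype) hr) (Submodule.Quotient.mk ⟨x, hx⟩)
  rw [← Submodule.Quotient.mk_smul, Submodule.Quotient.mk_eq_zero] at h1
  exact h1

namespace IsDiamond

variable {N₁ N₂ A B : Submodule R M} (h : IsDiamond N₁ N₂ A B)
include h

theorem lt : N₂ < N₁ := h.covA.lt.trans_le (h.sup_eq ▸ le_sup_left)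

theorem jacobson_smul_top [IsArtinianRing R] : Ring.jacobson R • (⊤ : Submodule R M) = N₁ := by
  have hco : N₁ ⋖ ⊤ := ⟨h.ne_top.lt_top, fun N h1 h2 => h1.not_ge (h.le_of_ne_top N h2.ne)⟩
  have hle := jacobson_smul_le_of_covBy hco
  set K := Ring.jacobson R • (⊤ : Submodule R M)
  have : IsSemisimpleModule R (M ⧸ K) := isSemisimpleModule_of_jacobson_le_annihilator <| by
    intro r hr
    refine Module.mem_annihilator.2 fun x => ?_
    obtain ⟨x, rfl⟩ := Submodule.Quotient.mk_surjective _ x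
    rw [← Submodule.Quotient.mk_smul, Submodule.Quotient.mk_eq_zero]
    exact Submodule.smul_mem_smul hr trivial
  obtain ⟨C, hC⟩ := exists_isCompl (N₁.map K.mkQ)
  by_cases hCt : C.comap K.mkQ = ⊤
  · have hCt' : C = ⊤ := by
      rw [← Submodule.map_comap_eq_of_surjective K.mkQ_surjective C, hCt, Submodule.map_top,
        Submodule.range_mkQ]
    have := hC.inf_eq_bot
    rw [hCt', inf_top_eq, ← LinearMap.le_ker_iff_map, Submodule.ker_mkQ] at this
    exact le_antisymm hle this
  · have h1 : C ≤ N₁.map K.mkQ := by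
      rw [← Submodule.map_comap_eq_of_surjective K.mkQ_surjective C]
      exact Submodule.map_mono (h.le_of_ne_top _ hCt)
    have h2 := hC.sup_eq_top
    rw [sup_eq_left.2 h1] at h2
    have h3 : (N₁.map K.mkQ).comap K.mkQ = ⊤ := by rw [h2, Submodule.comap_top]
    rw [Submodule.comap_map_mkQ, sup_eq_right.2 hle] at h3
    exact absurd h3 h.ne_top

theorem jacobson_smul_coatom [IsArtinianRing R] : Ring.jacobson R • N₁ = N₂ := by
  refine le_antisymm ?_ ?_
  · rw [← h.sup_eq, Submodule.smul_sup]
    exact sup_le (jacobson_smul_le_of_covBy h.covA) (jacobson_smul_le_of_covBy h.covB)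
  · refine h.ge_of_ne_bot _ fun h0 => ?_
    have : IsSemisimpleModule R N₁ := isSemisimpleModule_of_jacobson_le_annihilator <| by
      intro r hr
      refine Module.mem_annihilator.2 fun x => Subtype.ext ?_
      have := Submodule.smul_mem_smul hr x.2
      rw [h0] at this
      exact (Submodule.mem_bot R).1 this
    obtain ⟨C, hC⟩ := exists_isCompl (N₂.comap N₁.subtype)
    by_cases hCb : C.map N₁.subtype = ⊥
    · rw [← LinearMap.le_ker_iff_map, Submodule.ker_subtype, le_bot_iff] at hCb
      have := hC.sup_eq_top
      rw [hCb, sup_bot_eq, Submodule.comap_subtype_eq_top] at this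
      exact h.lt.not_ge this
    · have h1 := Submodule.comap_mono (f := N₁.subtype) (h.ge_of_ne_bot _ hCb)
      rw [Submodule.comap_map_eq_of_injective N₁.injective_subtype] at h1
      have h2 := hC.inf_eq_bot
      rw [inf_eq_left.2 h1] at h2
      refine h.ne_bot (le_bot_iff.1 fun x hx => ?_)
      have h3 : (⟨x, h.lt.le hx⟩ : N₁) ∈ N₂.comap N₁.subtype := hx
      rw [h2, Submodule.mem_bot] at h3
      exact congrArg Subtype.val h3

theorem sSup_simples : sSup {N : Submodule R M | IsSimpleModule R N} = N₂ := by
  refine le_antisymm (sSup_le fun N hN => ?_) (le_sSup ?_)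
  · have hN := isSimpleModule_iff_isAtom.1 hN
    exact ((hN.le_iff.1 (h.ge_of_ne_bot N hN.1)).resolve_left h.ne_bot).ge
  · exact isSimpleModule_iff_isAtom.2
      ⟨h.ne_bot, fun N hN => by_contra fun h0 => hN.not_ge (h.ge_of_ne_bot N h0)⟩

theorem comap_sSup_simples :
    (sSup {N : Submodule R (M ⧸ N₂) | IsSimpleModule R N}).comap N₂.mkQ = N₁ := by
  refine le_antisymm (h.le_of_ne_top _ fun ht => ?_) ?_
  · have : IsSemisimpleModule R (M ⧸ N₂) := by
      rw [← sSup_simples_eq_top_iff_isSemisimpleModule,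
        ← Submodule.map_comap_eq_of_surjective N₂.mkQ_surjective (sSup _), ht, Submodule.map_top,
        Submodule.range_mkQ]
    obtain ⟨C, hC⟩ := exists_isCompl (N₁.map N₂.mkQ)
    by_cases hCt : C.comap N₂.mkQ = ⊤
    · have hCt' : C = ⊤ := by
        rw [← Submodule.map_comap_eq_of_surjective N₂.mkQ_surjective C, hCt, Submodule.map_top,
          Submodule.range_mkQ]
      have := hC.inf_eq_bot
      rw [hCt', inf_top_eq, ← LinearMap.le_ker_iff_map, Submodule.ker_mkQ] at this
      exact h.lt.not_ge this
    · have h1 : C ≤ N₁.map N₂.mkQ := by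
        rw [← Submodule.map_comap_eq_of_surjective N₂.mkQ_surjective C]
        exact Submodule.map_mono (h.le_of_ne_top _ hCt)
      have h2 := hC.sup_eq_top
      rw [sup_eq_left.2 h1] at h2
      have h3 : (N₁.map N₂.mkQ).comap N₂.mkQ = ⊤ := by rw [h2, Submodule.comap_top]
      rw [Submodule.comap_map_mkQ, sup_eq_right.2 h.lt.le] at h3
      exact h.ne_top h3
  · have key : ∀ C : Submodule R M, N₂ ⋖ C →
        C ≤ (sSup {N : Submodule R (M ⧸ N₂) | IsSimpleModule R N}).comap N₂.mkQ := by
      intro C hC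
      rw [← Submodule.map_le_iff_le_comap]
      refine le_sSup (isSimpleModule_iff_isAtom.2 ⟨fun h0 => ?_, fun N hN => ?_⟩)
      · rw [← LinearMap.le_ker_iff_map, Submodule.ker_mkQ] at h0
        exact hC.lt.not_ge h0
      · have h1 : N.comap N₂.mkQ < C := by
          refine lt_of_le_of_ne ?_ ?_
          · have := Submodule.comap_mono (f := N₂.mkQ) hN.le
            rwa [Submodule.comap_map_mkQ, sup_eq_right.2 hC.lt.le] at this
          · rintro rfl
            rw [Submodule.map_comap_eq_of_surjective N₂.mkQ_surjective] at hN
            exact hN.ne rfl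
        have h2 : N₂ ≤ N.comap N₂.mkQ := Submodule.le_comap_mkQ _ _
        have h3 : N.comap N₂.mkQ = N₂ :=
          by_contra fun h4 => hC.2 (lt_of_le_of_ne h2 (Ne.symm h4)) h1
        rw [← Submodule.map_comap_eq_of_surjective N₂.mkQ_surjective N, h3,
          ← LinearMap.le_ker_iff_map, Submodule.ker_mkQ]
    conv_lhs => rw [← h.sup_eq]
    exact sup_le (key A h.covA) (key B h.covB)

end IsDiamond

variable {𝕜 m n ξ} in
theorem radical_socle_of_isDiamond {P : Type} [AddCommGroup P] [Module (H 𝕜 m n ξ) P]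
    [IsArtinianRing (H 𝕜 m n ξ)] {N₁ N₂ A B : Submodule (H 𝕜 m n ξ) P}
    (h : IsDiamond N₁ N₂ A B) :
    radM 𝕜 m n ξ P =
      Submodule.comap (socle 𝕜 m n ξ P).mkQ (socle 𝕜 m n ξ (P ⧸ socle 𝕜 m n ξ P)) ∧
    rad2M 𝕜 m n ξ P = socle 𝕜 m n ξ P := by
  have hJ : jrad 𝕜 m n ξ = Ring.jacobson (H 𝕜 m n ξ) := Ideal.jacobson_bot
  have h1 : radM 𝕜 m n ξ P = N₁ := by
    rw [← h.jacobson_smul_top, radM, hJ]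
    refine le_antisymm (Submodule.span_le.2 ?_) (Submodule.smul_le.2 fun r hr x _ => ?_)
    · rintro _ ⟨r, hr, x, rfl⟩
      exact Submodule.smul_mem_smul hr trivial
    · exact Submodule.subset_span ⟨r, hr, x, rfl⟩
  have h2 : rad2M 𝕜 m n ξ P = N₂ := by
    rw [← h.jacobson_smul_coatom, ← h.jacobson_smul_top, rad2M, hJ]
    refine le_antisymm (Submodule.span_le.2 ?_) (Submodule.smul_le.2 fun r hr x hx => ?_)
    · rintro _ ⟨r, hr, s, hs, x, rfl⟩
      exact Submodule.smul_mem_smul hr (Submodule.smul_mem_smul hs trivial)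
    · induction hx using Submodule.smul_induction_on' with
      | smul s hs y _ => exact Submodule.subset_span ⟨r, hr, s, hs, y, rfl⟩
      | add y _ z _ hy hz => rw [smul_add]; exact add_mem hy hz
  have h3 : socle 𝕜 m n ξ P = N₂ := h.sSup_simples
  rw [h1, h2, h3]
  exact ⟨h.comap_sSup_simples.symm, rfl⟩

end Lattice

section QCommute

variable {K R : Type*} [Field K] [Ring R] [Algebra K R] {x y z : R} {s t : K}

theorem qcomm_pow_left (h : x * y = s • (y * x)) (k : ℕ) : x ^ k * y = s ^ k • (y * x ^ k) := by
  induction k with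
  | zero => simp
  | succ k ih =>
    rw [pow_succ, mul_assoc, h, mul_smul_comm, ← mul_assoc, ih, smul_mul_assoc, smul_smul,
      mul_assoc, ← pow_succ, ← pow_succ']

theorem qcomm_pow_right (h : x * y = s • (y * x)) (k : ℕ) : x * y ^ k = s ^ k • (y ^ k * x) := by
  induction k with
  | zero => simp
  | succ k ih =>
    rw [pow_succ, ← mul_assoc, ih, smul_mul_assoc, mul_assoc, h, mul_smul_comm, smul_smul,
      ← mul_assoc, ← pow_succ]

theorem qcomm_symm (hs : s ≠ 0) (h : x * y = s • (y * x)) : y * x = s⁻¹ • (x * y) := by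
  rw [h, inv_smul_smul₀ hs]

end QCommute

section Shift

variable {𝕜 m n ξ} {R : Type*} [Ring R] [Algebra 𝕜 R] {a b c d E F : R}

variable (m n ξ) in
/-- The relations of `H_{mn}(ξ)` without those on `aⁿ`, `b^{mn}`, `c^{mn}`. -/
structure DrinfeldRel (a b c d : R) : Prop where
  ab : a * b = ξ ^ m • (b * a)
  dc : d * c = ξ • (c * d)
  bc : b * c = c * b
  bd : b * d = ξ ^ m • (d * b)
  ad : a * d - d * a = b - c ^ m
  ac : a * c = ξ⁻¹ • (c * a) + ((ξ⁻¹ - ξ ^ (n - 1)) / qFact 𝕜 (ξ ^ m) (n - 1)) •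
    ((c ^ (m + 1) - ξ ^ m • (b * c)) * d ^ (n - 1))
  dPow : d ^ n = 0

variable (m n ξ) in
/-- The relations satisfied by `E = a + D`, `b`, `c` and `F = d`, where `D` is `shiftTerm`. -/
structure ShiftedRel (E b c F : R) : Prop where
  Eb : E * b = ξ ^ m • (b * E)
  Ec : E * c = ξ⁻¹ • (c * E)
  Fc : F * c = ξ • (c * F)
  bc : b * c = c * b
  bF : b * F = ξ ^ m • (F * b)
  EF : E * F = F * E + (b - c ^ m)
  FPow : F ^ n = 0

variable (m n ξ) in
/-- The correction `D = (cᵐ - q b) dⁿ⁻¹ / (n-1)!_q`. -/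
def shiftTerm (b c d : R) : R :=
  (qFact 𝕜 (ξ ^ m) (n - 1))⁻¹ • ((c ^ m - ξ ^ m • b) * d ^ (n - 1))

section Commutation

variable (hξ : ξ ≠ 0) (hq : (ξ ^ m) ^ n = 1) (hn : 1 < n)
  (dc : d * c = ξ • (c * d)) (bc : b * c = c * b) (bd : b * d = ξ ^ m • (d * b)) (dn : d ^ n = 0)

include dc bc in
theorem shiftTerm_mul_c :
    shiftTerm m n ξ b c d * c = ξ ^ (n - 1) • (c * shiftTerm m n ξ b c d) := by
  have h : (c ^ m - ξ ^ m • b) * c = c * (c ^ m - ξ ^ m • b) := by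
    rw [sub_mul, mul_sub, ← pow_succ, ← pow_succ', smul_mul_assoc, bc, mul_smul_comm]
  rw [shiftTerm, smul_mul_assoc, mul_assoc, qcomm_pow_left dc, mul_smul_comm, ← mul_assoc, h,
    mul_smul_comm, smul_comm, mul_assoc]

include hξ hq hn bc bd in
theorem shiftTerm_mul_b :
    shiftTerm m n ξ b c d * b = ξ ^ m • (b * shiftTerm m n ξ b c d) := by
  have h : (c ^ m - ξ ^ m • b) * b = b * (c ^ m - ξ ^ m • b) := by
    rw [sub_mul, mul_sub, (show Commute b c from bc).symm.pow_left m |>.eq, smul_mul_assoc,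
      mul_smul_comm]
  have h2 := qcomm_pow_left (qcomm_symm (pow_ne_zero m hξ) bd) (n - 1)
  have h3 : ((ξ ^ m)⁻¹) ^ (n - 1) = ξ ^ m := by
    rw [inv_pow]
    refine inv_eq_of_mul_eq_one_right ?_
    rw [← pow_succ, Nat.sub_add_cancel hn.le, hq]
  rw [h3] at h2
  rw [shiftTerm, smul_mul_assoc, mul_assoc, h2, mul_smul_comm, ← mul_assoc, h,
    mul_smul_comm, smul_comm, mul_assoc]

include hn dn in
theorem shiftTerm_mul_d : shiftTerm m n ξ b c d * d = 0 := by
  rw [shiftTerm, smul_mul_assoc, mul_assoc, ← pow_succ, Nat.sub_add_cancel hn.le, dn, mul_zero,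
    smul_zero]

include hξ hn dc bd dn in
theorem d_mul_shiftTerm : d * shiftTerm m n ξ b c d = 0 := by
  rw [shiftTerm, mul_smul_comm, ← mul_assoc, mul_sub, qcomm_pow_right dc, mul_smul_comm,
    qcomm_symm (pow_ne_zero m hξ) bd, smul_inv_smul₀ (pow_ne_zero m hξ), ← smul_mul_assoc _ (c ^ m),
    ← sub_mul, mul_assoc, ← pow_succ', Nat.sub_add_cancel hn.le, dn, mul_zero,
    smul_zero]

include bc in
theorem c_mul_shiftTerm : (qFact 𝕜 (ξ ^ m) (n - 1))⁻¹ •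
    ((c ^ (m + 1) - ξ ^ m • (b * c)) * d ^ (n - 1)) = c * shiftTerm m n ξ b c d := by
  rw [shiftTerm, mul_smul_comm, ← mul_assoc, mul_sub, ← pow_succ', mul_smul_comm, bc]

end Commutation

theorem DrinfeldRel.shifted (hξ : ξ ≠ 0) (hq : (ξ ^ m) ^ n = 1) (hn : 1 < n)
    (h : DrinfeldRel m n ξ a b c d) :
    ShiftedRel m n ξ (a + shiftTerm m n ξ b c d) b c d where
  Eb := by rw [add_mul, h.ab, shiftTerm_mul_b hξ hq hn h.bc h.bd, mul_add, smul_add]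
  Ec := by
    rw [add_mul, h.ac, shiftTerm_mul_c h.dc h.bc, mul_add, smul_add, add_assoc, div_eq_mul_inv,
      mul_smul, c_mul_shiftTerm h.bc, ← add_smul, sub_add_cancel]
  Fc := h.dc
  bc := h.bc
  bF := h.bd
  EF := by
    rw [add_mul, mul_add, shiftTerm_mul_d hn h.dPow, d_mul_shiftTerm hξ hn h.dc h.bd h.dPow,
      add_zero, add_zero, ← h.ad]
    abel
  FPow := h.dPow

theorem ShiftedRel.unshifted (hξ : ξ ≠ 0) (hq : (ξ ^ m) ^ n = 1) (hn : 1 < n)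
    (h : ShiftedRel m n ξ E b c F) :
    DrinfeldRel m n ξ (E - shiftTerm m n ξ b c F) b c F where
  ab := by rw [sub_mul, h.Eb, shiftTerm_mul_b hξ hq hn h.bc h.bF, mul_sub, smul_sub]
  ac := by
    rw [sub_mul, h.Ec, shiftTerm_mul_c h.Fc h.bc, mul_sub, smul_sub, div_eq_mul_inv, mul_smul,
      c_mul_shiftTerm h.bc, sub_smul]
    abel
  dc := h.Fc
  bc := h.bc
  bd := h.bF
  ad := by
    rw [sub_mul, mul_sub, shiftTerm_mul_d hn h.FPow, d_mul_shiftTerm hξ hn h.Fc h.bF h.FPow,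
      sub_zero, sub_zero, h.EF]
    abel
  dPow := h.FPow

namespace ShiftedRel

variable (h : ShiftedRel m n ξ E b c F) (hξ : ξ ≠ 0)
include h hξ

theorem pow_F_mul_E (k : ℕ) : ∃ s t : 𝕜,
    F ^ (k + 1) * E = E * F ^ (k + 1) + (s • b + t • c ^ m) * F ^ k := by
  induction k with
  | zero =>
    refine ⟨-1, 1, ?_⟩
    simp only [zero_add, pow_one, pow_zero, mul_one, h.EF]
    module
  | succ k ih =>
    obtain ⟨s, t, ih⟩ := ih
    refine ⟨s * (ξ ^ m)⁻¹ - 1, t * ξ ^ m + 1, ?_⟩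
    have hF : F * (s • b + t • c ^ m) = ((s * (ξ ^ m)⁻¹) • b + (t * ξ ^ m) • c ^ m) * F := by
      rw [mul_add, mul_smul_comm, mul_smul_comm, qcomm_pow_right h.Fc,
        qcomm_symm (pow_ne_zero m hξ) h.bF]
      simp only [add_mul, smul_mul_assoc, mul_smul]
    have hEF : F * E = E * F - (b - c ^ m) := by rw [h.EF]; abel
    calc F ^ (k + 2) * E = F * (F ^ (k + 1) * E) := by rw [pow_succ' F (k + 1), mul_assoc]
      _ = (F * E) * F ^ (k + 1) + F * (s • b + t • c ^ m) * F ^ k := by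
        rw [ih, mul_add]; simp only [mul_assoc]
      _ = _ := by
        rw [hEF, hF, mul_assoc _ F, ← pow_succ', sub_mul, mul_assoc E, ← pow_succ']
        simp only [sub_smul, add_smul, one_smul, add_mul, sub_mul]
        abel

theorem F_mul_pow_E (k : ℕ) : ∃ s t : 𝕜,
    F * E ^ (k + 1) = E ^ (k + 1) * F + E ^ k * (s • b + t • c ^ m) := by
  induction k with
  | zero =>
    refine ⟨-1, 1, ?_⟩
    simp only [zero_add, pow_one, pow_zero, one_mul, h.EF]
    module
  | succ k ih =>
    obtain ⟨s, t, ih⟩ := ih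
    refine ⟨s * (ξ ^ m)⁻¹ - 1, t * ξ⁻¹⁻¹ ^ m + 1, ?_⟩
    have hE : (s • b + t • c ^ m) * E
        = E * ((s * (ξ ^ m)⁻¹) • b + (t * ξ⁻¹⁻¹ ^ m) • c ^ m) := by
      rw [add_mul, smul_mul_assoc, smul_mul_assoc, qcomm_symm (pow_ne_zero m hξ) h.Eb,
        qcomm_pow_left (qcomm_symm (inv_ne_zero hξ) h.Ec)]
      simp only [mul_add, mul_smul_comm, mul_smul]
    have hEF : F * E = E * F - (b - c ^ m) := by rw [h.EF]; abel
    calc F * E ^ (k + 2) = (F * E ^ (k + 1)) * E := by rw [pow_succ E (k + 1), mul_assoc]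
      _ = E ^ (k + 1) * (F * E) + E ^ k * ((s • b + t • c ^ m) * E) := by
        rw [ih, add_mul]; simp only [mul_assoc]
      _ = _ := by
        rw [hEF, hE, ← mul_assoc (E ^ k), ← pow_succ, mul_sub, ← mul_assoc, ← pow_succ]
        simp only [sub_smul, add_smul, one_smul, mul_add, mul_sub]
        abel

theorem pow_F_mul_pow_E_mul_pow_F (hn : 1 < n) (j : ℕ) : F ^ (j + 1) * E ^ j * F ^ (n - 1) = 0 := by
  induction j with
  | zero => rw [zero_add, pow_one, pow_zero, mul_one, ← pow_succ', Nat.sub_add_cancel hn.le, h.FPow]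
  | succ j ih =>
    obtain ⟨s, t, hst⟩ := h.pow_F_mul_E hξ (j + 1)
    calc F ^ (j + 2) * E ^ (j + 1) * F ^ (n - 1)
        = F ^ (j + 2) * E * (E ^ j * F ^ (n - 1)) := by
          rw [pow_succ' E j]; simp only [mul_assoc]
      _ = E * F * (F ^ (j + 1) * E ^ j * F ^ (n - 1))
          + (s • b + t • c ^ m) * (F ^ (j + 1) * E ^ j * F ^ (n - 1)) := by
          rw [hst, add_mul, pow_succ' F (j + 1)]; simp only [mul_assoc]
      _ = 0 := by rw [ih, mul_zero, mul_zero, add_zero]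

theorem shiftTerm_mul_pow_mul_shiftTerm (hn : 1 < n) (j : ℕ) (hj : j + 2 ≤ n) :
    shiftTerm m n ξ b c F * E ^ j * shiftTerm m n ξ b c F = 0 := by
  have h0 : F ^ (n - 1) * E ^ j * F ^ (n - 1) = 0 := by
    have : n - 1 = (n - 2 - j) + (j + 1) := by omega
    conv_lhs => enter [1, 1]; rw [this, pow_add]
    rw [mul_assoc, mul_assoc, ← mul_assoc (F ^ (j + 1)), h.pow_F_mul_pow_E_mul_pow_F hξ hn,
      mul_zero]
  have hbD : F ^ (n - 1) * E ^ j * (b * F ^ (n - 1)) = 0 := by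
    rw [← mul_assoc, mul_assoc _ (E ^ j), qcomm_pow_left h.Eb, mul_smul_comm, ← mul_assoc,
      qcomm_pow_left (qcomm_symm (pow_ne_zero m hξ) h.bF), smul_mul_assoc, smul_mul_assoc,
      smul_mul_assoc, mul_assoc b, mul_assoc b, h0, mul_zero, smul_zero, smul_zero]
  have hcD : F ^ (n - 1) * E ^ j * (c ^ m * F ^ (n - 1)) = 0 := by
    rw [← mul_assoc, mul_assoc _ (E ^ j), qcomm_pow_left (qcomm_pow_right h.Ec m), mul_smul_comm,
      ← mul_assoc, qcomm_pow_left (qcomm_pow_right h.Fc m), smul_mul_assoc, smul_mul_assoc,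
      smul_mul_assoc, mul_assoc (c ^ m), mul_assoc (c ^ m), h0, mul_zero, smul_zero, smul_zero]
  have h1 : F ^ (n - 1) * E ^ j * shiftTerm m n ξ b c F = 0 := by
    rw [shiftTerm, mul_smul_comm, sub_mul, mul_sub, hcD, smul_mul_assoc, mul_smul_comm, hbD,
      smul_zero, sub_zero, smul_zero]
  conv_lhs => enter [1, 1]; rw [shiftTerm]
  rw [smul_mul_assoc, smul_mul_assoc, mul_assoc _ _ (E ^ j), mul_assoc, h1, mul_zero, smul_zero]

theorem exists_sub_shiftTerm_pow (hn : 1 < n) (k : ℕ) : ∃ S : R,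
    (k ≤ n → (E - shiftTerm m n ξ b c F) ^ k = E ^ k - S) ∧
    (∀ j, k + j + 1 ≤ n → S * E ^ j * shiftTerm m n ξ b c F = 0) ∧
    ξ ^ k • (S * c) = ξ ^ n • (c * S) := by
  induction k with
  | zero => exact ⟨0, by simp⟩
  | succ k ih =>
    obtain ⟨S, h1, h2, h3⟩ := ih
    set D := shiftTerm m n ξ b c F with hD
    refine ⟨S * E + E ^ k * D, fun hk => ?_, fun j hj => ?_, ?_⟩
    · rw [pow_succ, h1 (by omega), sub_mul, mul_sub, mul_sub]
      have := h2 0 (by omega)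
      rw [pow_zero, mul_one] at this
      rw [this, ← pow_succ]
      abel
    · have h4 := h2 (j + 1) (by omega)
      rw [pow_succ', ← mul_assoc] at h4
      rw [add_mul, add_mul, h4, zero_add, mul_assoc, mul_assoc, ← mul_assoc D,
        h.shiftTerm_mul_pow_mul_shiftTerm hξ hn j (by omega), mul_zero]
    · rw [add_mul, mul_assoc, h.Ec, mul_assoc _ D, shiftTerm_mul_c h.Fc h.bc, mul_smul_comm,
        mul_smul_comm, ← mul_assoc, ← mul_assoc, qcomm_pow_left h.Ec, smul_mul_assoc, ← hD,
        smul_add, mul_add, smul_add]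
      congr 1
      · rw [pow_succ, mul_smul, smul_inv_smul₀ hξ, ← smul_mul_assoc, h3, smul_mul_assoc, mul_assoc]
      · rw [smul_smul, smul_smul, mul_assoc c]
        congr 1
        rw [show n = (n - 1) + 1 by omega, Nat.add_sub_cancel, pow_succ, pow_succ, inv_pow]
        field_simp

theorem pow_E_eq_zero (hn : 1 < n) (hξn : ξ ^ n ≠ 1) (hcu : IsUnit c)
    (han : (E - shiftTerm m n ξ b c F) ^ n = b ^ n - 1) : E ^ n = 0 := by
  obtain ⟨S, h1, -, h3⟩ := h.exists_sub_shiftTerm_pow hξ hn n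
  have h1 := (h1 le_rfl).symm.trans han
  have h4 : E ^ n = b ^ n - 1 + S := by rw [← h1]; abel
  have h5 : S * c = c * S := smul_right_injective _ (pow_ne_zero n hξ) h3
  have h6 : E ^ n * c = c * E ^ n := by
    rw [h4, add_mul, mul_add, h5, sub_mul, mul_sub, (show Commute b c from h.bc).pow_left n |>.eq,
      one_mul, mul_one]
  rw [qcomm_pow_left h.Ec, inv_pow, inv_smul_eq_iff₀ (pow_ne_zero n hξ), eq_comm,
    ← sub_eq_zero] at h6
  have h7 : (ξ ^ n - 1) • (c * E ^ n) = 0 := by rw [sub_smul, one_smul, h6]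
  rw [smul_eq_zero_iff_right (sub_ne_zero.2 hξn)] at h7
  exact hcu.mul_right_eq_zero.1 h7

end ShiftedRel

end Shift

section Presentation

variable {𝕜 m n ξ}

variable (𝕜 m n ξ) in
/-- The projection of the free algebra onto `H_{mn}(ξ)`. -/
def proj : FreeAlgebra 𝕜 (Fin 4) →ₐ[𝕜] H 𝕜 m n ξ := RingQuot.mkAlgHom 𝕜 (HRel 𝕜 m n ξ)

theorem proj_surjective : Function.Surjective (proj 𝕜 m n ξ) :=
  RingQuot.mkAlgHom_surjective 𝕜 (HRel 𝕜 m n ξ)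

@[simp]
theorem proj_fgen (k : Fin 4) : proj 𝕜 m n ξ (fgen 𝕜 k) = gen 𝕜 m n ξ k := rfl

theorem proj_eq_of_hRel {x y : FreeAlgebra 𝕜 (Fin 4)} (h : HRel 𝕜 m n ξ x y) :
    proj 𝕜 m n ξ x = proj 𝕜 m n ξ y :=
  RingQuot.mkAlgHom_rel 𝕜 h

theorem drinfeldRel_gen : DrinfeldRel m n ξ ha hb hc hd where
  ab := by simpa using proj_eq_of_hRel (HRel.ab (𝕜 := 𝕜) (m := m) (n := n) (ξ := ξ))
  dc := by simpa using proj_eq_of_hRel (HRel.dc (𝕜 := 𝕜) (m := m) (n := n) (ξ := ξ))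
  bc := by simpa using proj_eq_of_hRel (HRel.bc (𝕜 := 𝕜) (m := m) (n := n) (ξ := ξ))
  bd := by simpa using proj_eq_of_hRel (HRel.bd (𝕜 := 𝕜) (m := m) (n := n) (ξ := ξ))
  ad := by simpa using proj_eq_of_hRel (HRel.ad (𝕜 := 𝕜) (m := m) (n := n) (ξ := ξ))
  ac := by simpa using proj_eq_of_hRel (HRel.ac (𝕜 := 𝕜) (m := m) (n := n) (ξ := ξ))
  dPow := by simpa using proj_eq_of_hRel (HRel.dPow (𝕜 := 𝕜) (m := m) (n := n) (ξ := ξ))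

theorem gen_a_pow : (ha : H 𝕜 m n ξ) ^ n = hb ^ n - 1 := by
  simpa using proj_eq_of_hRel (HRel.aPow (𝕜 := 𝕜) (m := m) (n := n) (ξ := ξ))

theorem gen_b_pow : (hb : H 𝕜 m n ξ) ^ (m * n) = 1 := by
  simpa using proj_eq_of_hRel (HRel.bPow (𝕜 := 𝕜) (m := m) (n := n) (ξ := ξ))

theorem gen_c_pow : (hc : H 𝕜 m n ξ) ^ (m * n) = 1 := by
  simpa using proj_eq_of_hRel (HRel.cPow (𝕜 := 𝕜) (m := m) (n := n) (ξ := ξ))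

variable (𝕜 m n ξ) in
/-- The element `E = a + D` of `H_{mn}(ξ)`, which skew-commutes with `b` and `c`. -/
def hE : H 𝕜 m n ξ := ha + shiftTerm m n ξ hb hc hd

theorem gen_a_eq : (ha : H 𝕜 m n ξ) = hE 𝕜 m n ξ - shiftTerm m n ξ hb hc hd := by
  rw [hE, add_sub_cancel_right]

theorem gen_induction {p : H 𝕜 m n ξ → Prop} (hs : ∀ s : 𝕜, p (algebraMap 𝕜 _ s))
    (hgen : ∀ k, p (gen 𝕜 m n ξ k)) (hadd : ∀ x y, p x → p y → p (x + y))
    (hmul : ∀ x y, p x → p y → p (x * y)) (x : H 𝕜 m n ξ) : p x := by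
  obtain ⟨x, rfl⟩ := proj_surjective x
  induction x using FreeAlgebra.induction with
  | grade0 s => rw [AlgHom.commutes]; exact hs s
  | grade1 k => exact hgen k
  | mul x y hx hy => rw [map_mul]; exact hmul _ _ hx hy
  | add x y hx hy => rw [map_add]; exact hadd _ _ hx hy

theorem shifted_induction {p : H 𝕜 m n ξ → Prop} (hs : ∀ s : 𝕜, p (algebraMap 𝕜 _ s))
    (hE : p (hE 𝕜 m n ξ)) (pb : p hb) (pc : p hc) (pd : p hd)
    (hadd : ∀ x y, p x → p y → p (x + y))
    (hmul : ∀ x y, p x → p y → p (x * y)) (x : H 𝕜 m n ξ) : p x := by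
  have hsm : ∀ (s : 𝕜) x, p x → p (s • x) := fun s x hx => by
    rw [Algebra.smul_def]; exact hmul _ _ (hs s) hx
  have hpow : ∀ (k : ℕ) x, p x → p (x ^ k) := fun k x hx => by
    induction k with
    | zero => simpa using hs 1
    | succ k ih => rw [pow_succ]; exact hmul _ _ ih hx
  have hsub : ∀ x y, p x → p y → p (x - y) := fun x y hx hy => by
    rw [sub_eq_add_neg, ← neg_one_smul 𝕜 y]; exact hadd _ _ hx (hsm _ _ hy)
  refine gen_induction hs (fun k => ?_) hadd hmul x
  fin_cases k
  · change p ha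
    rw [gen_a_eq]
    exact hsub _ _ hE (hsm _ _ (hmul _ _ (hsub _ _ (hpow _ _ pc) (hsm _ _ pb)) (hpow _ _ pd)))
  · exact pb
  · exact pc
  · exact pd

section Roots

variable (hm : 1 < m) (hn : 1 < n) (hξ : IsPrimitiveRoot ξ (m * n))
include hm hn hξ

theorem root_ne_zero : ξ ≠ 0 := hξ.ne_zero (by positivity)

theorem isPrimitiveRoot_q : IsPrimitiveRoot (ξ ^ m) n := hξ.pow (by positivity) rfl

theorem root_pow_ne_one : ξ ^ n ≠ 1 :=
  hξ.pow_ne_one_of_pos_of_lt (by omega) (by nlinarith)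

theorem shiftedRel_gen : ShiftedRel m n ξ (hE 𝕜 m n ξ) hb hc hd :=
  drinfeldRel_gen.shifted (root_ne_zero hm hn hξ) (isPrimitiveRoot_q hm hn hξ).pow_eq_one hn

theorem hE_pow : hE 𝕜 m n ξ ^ n = 0 :=
  (shiftedRel_gen hm hn hξ).pow_E_eq_zero (root_ne_zero hm hn hξ) hn (root_pow_ne_one hm hn hξ)
    (IsUnit.of_pow_eq_one gen_c_pow (by positivity)) (by rw [← gen_a_eq, gen_a_pow])

theorem finite_H : Module.Finite 𝕜 (H 𝕜 m n ξ) := by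
  have hR := shiftedRel_gen (𝕜 := 𝕜) hm hn hξ
  have h0 := root_ne_zero hm hn hξ
  have hmn : 0 < m * n := by positivity
  let f : ℕ → ℕ → ℕ → ℕ → H 𝕜 m n ξ := fun i j k l => hE 𝕜 m n ξ ^ i * hb ^ j * hc ^ k * hd ^ l
  let X : Set (H 𝕜 m n ξ) := Set.range fun t : Fin n × Fin (m * n) × Fin (m * n) × Fin n =>
    f t.1 t.2.1 t.2.2.1 t.2.2.2
  have hf : ∀ i j k l, f i j k l ∈ Submodule.span 𝕜 X := by
    intro i j k l
    by_cases hi : i < n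
    · by_cases hl : l < n
      · refine Submodule.subset_span ⟨(⟨i, hi⟩, ⟨j % (m * n), Nat.mod_lt _ hmn⟩,
          ⟨k % (m * n), Nat.mod_lt _ hmn⟩, ⟨l, hl⟩), ?_⟩
        simp only [f]
        rw [← pow_eq_pow_mod j gen_b_pow, ← pow_eq_pow_mod k gen_c_pow]
      · have : (hd : H 𝕜 m n ξ) ^ l = 0 := pow_eq_zero_of_le (by omega) hR.FPow
        simp [f, this]
    · have : hE 𝕜 m n ξ ^ i = 0 := pow_eq_zero_of_le (by omega) (hE_pow hm hn hξ)
      simp [f, this]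
  have hstable : ∀ y : H 𝕜 m n ξ, (∀ i j k l, y * f i j k l ∈ Submodule.span 𝕜 X) →
      ∀ x ∈ Submodule.span 𝕜 X, y * x ∈ Submodule.span 𝕜 X := by
    intro y hy x hx
    induction hx using Submodule.span_induction with
    | mem x hx => obtain ⟨t, rfl⟩ := hx; exact hy _ _ _ _
    | zero => rw [mul_zero]; exact zero_mem _
    | add x y _ _ hx hy => rw [mul_add]; exact add_mem hx hy
    | smul s x _ hx => rw [mul_smul_comm]; exact Submodule.smul_mem _ _ hx
  have hbE := fun i => qcomm_pow_right (qcomm_symm (pow_ne_zero m h0) hR.Eb) i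
  have hcE := fun i => qcomm_pow_right (qcomm_symm (inv_ne_zero h0) hR.Ec) i
  have hFb := fun j => qcomm_pow_right (qcomm_symm (pow_ne_zero m h0) hR.bF) j
  have hFc := fun k => qcomm_pow_right hR.Fc k
  have stE : ∀ x ∈ Submodule.span 𝕜 X, hE 𝕜 m n ξ * x ∈ Submodule.span 𝕜 X :=
    hstable _ fun i j k l => by
      have : hE 𝕜 m n ξ * f i j k l = f (i + 1) j k l := by
        simp only [f, pow_succ', mul_assoc]
      rw [this]; exact hf _ _ _ _
  have f_b : ∀ i j k l, hE 𝕜 m n ξ ^ i * hb * (hb ^ j * hc ^ k * hd ^ l) = f i (j + 1) k l := by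
    intro i j k l
    simp only [f, pow_succ', mul_assoc]
  have f_c : ∀ (i j k l p : ℕ),
      hE 𝕜 m n ξ ^ i * hc ^ p * (hb ^ j * hc ^ k * hd ^ l) = f i j (p + k) l := by
    intro i j k l p
    have := ((show Commute (hb : H 𝕜 m n ξ) hc from hR.bc).pow_pow j p).eq
    simp only [f]
    rw [mul_assoc _ (hc ^ p), ← mul_assoc (hc ^ p), ← mul_assoc (hc ^ p), ← this, pow_add]
    simp only [mul_assoc]
  have stb : ∀ x ∈ Submodule.span 𝕜 X, hb * x ∈ Submodule.span 𝕜 X :=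
    hstable _ fun i j k l => by
      have : hb * f i j k l = ((ξ ^ m)⁻¹) ^ i • f i (j + 1) k l := by
        rw [← f_b, ← smul_mul_assoc, ← hbE]
        simp only [f, mul_assoc]
      rw [this]; exact Submodule.smul_mem _ _ (hf _ _ _ _)
  have stc : ∀ x ∈ Submodule.span 𝕜 X, hc * x ∈ Submodule.span 𝕜 X :=
    hstable _ fun i j k l => by
      have : hc * f i j k l = (ξ⁻¹⁻¹) ^ i • f i j (1 + k) l := by
        rw [← f_c, ← smul_mul_assoc, pow_one, ← hcE]
        simp only [f, mul_assoc]
      rw [this]; exact Submodule.smul_mem _ _ (hf _ _ _ _)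
  have hdbc : ∀ j k l, (hd : H 𝕜 m n ξ) * (hb ^ j * hc ^ k * hd ^ l) =
      (((ξ ^ m)⁻¹) ^ j * ξ ^ k) • (hb ^ j * hc ^ k * hd ^ (l + 1)) := by
    intro j k l
    rw [mul_assoc, ← mul_assoc, hFb, smul_mul_assoc, mul_assoc, ← mul_assoc hd, hFc,
      smul_mul_assoc, mul_smul_comm, smul_smul, mul_assoc (hc ^ k), ← pow_succ', ← mul_assoc]
  have std : ∀ x ∈ Submodule.span 𝕜 X, hd * x ∈ Submodule.span 𝕜 X :=
    hstable _ fun i j k l => by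
      have h1 : hE 𝕜 m n ξ ^ i * hd * (hb ^ j * hc ^ k * hd ^ l) ∈ Submodule.span 𝕜 X := by
        rw [mul_assoc, hdbc, mul_smul_comm, ← mul_assoc, ← mul_assoc]
        exact Submodule.smul_mem _ _ (hf _ _ _ _)
      cases i with
      | zero =>
        have : hd * f 0 j k l = hE 𝕜 m n ξ ^ 0 * hd * (hb ^ j * hc ^ k * hd ^ l) := by
          simp only [f, pow_zero, one_mul]
        rw [this]; exact h1
      | succ i =>
        obtain ⟨s, t, hst⟩ := hR.F_mul_pow_E h0 i
        have : hd * f (i + 1) j k l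
            = hE 𝕜 m n ξ ^ (i + 1) * hd * (hb ^ j * hc ^ k * hd ^ l) + s • f i (j + 1) k l
              + t • f i j (m + k) l := by
          have h2 : hd * f (i + 1) j k l
              = hd * hE 𝕜 m n ξ ^ (i + 1) * (hb ^ j * hc ^ k * hd ^ l) := by
            simp only [f, mul_assoc]
          rw [h2, hst, add_mul, mul_add, add_mul, mul_smul_comm, mul_smul_comm, smul_mul_assoc,
            smul_mul_assoc, f_b, f_c, add_assoc]
        rw [this]
        exact add_mem (add_mem h1 (Submodule.smul_mem _ _ (hf _ _ _ _)))
          (Submodule.smul_mem _ _ (hf _ _ _ _))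
  have key : ∀ x : H 𝕜 m n ξ, ∀ y ∈ Submodule.span 𝕜 X, x * y ∈ Submodule.span 𝕜 X := by
    refine shifted_induction (fun s y hy => ?_) stE stb stc std (fun x y hx hy z hz => ?_)
      (fun x y hx hy z hz => ?_)
    · rw [← Algebra.smul_def]; exact Submodule.smul_mem _ _ hy
    · rw [add_mul]; exact add_mem (hx z hz) (hy z hz)
    · rw [mul_assoc]; exact hx _ (hy z hz)
  have h1 : (1 : H 𝕜 m n ξ) ∈ Submodule.span 𝕜 X := by simpa [f] using hf 0 0 0 0
  refine ⟨(Submodule.fg_def).2 ⟨X, Set.finite_range _, eq_top_iff.2 fun x _ => ?_⟩⟩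
  simpa using key x 1 h1

theorem isArtinianRing_H : IsArtinianRing (H 𝕜 m n ξ) :=
  have := finite_H (𝕜 := 𝕜) hm hn hξ
  IsArtinianRing.of_finite 𝕜 _

end Roots

section Stable

variable {M N : Type*} [AddCommGroup M] [Module 𝕜 M] [Module (H 𝕜 m n ξ) M]
  [IsScalarTower 𝕜 (H 𝕜 m n ξ) M] [AddCommGroup N] [Module 𝕜 N] [Module (H 𝕜 m n ξ) N]
  [IsScalarTower 𝕜 (H 𝕜 m n ξ) N]

/-- A `𝕜`-subspace stable under `E`, `b`, `c`, `d` is an `H`-submodule. -/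
def stableSubmodule (S : Submodule 𝕜 M) (sE : ∀ x ∈ S, hE 𝕜 m n ξ • x ∈ S)
    (sb : ∀ x ∈ S, hb • x ∈ S) (sc : ∀ x ∈ S, hc • x ∈ S) (sd : ∀ x ∈ S, hd • x ∈ S) :
    Submodule (H 𝕜 m n ξ) M where
  __ := S.toAddSubmonoid
  smul_mem' := by
    refine shifted_induction (fun s x hx => ?_) (sE _) (sb _) (sc _) (sd _)
      (fun x y hx hy z hz => ?_) (fun x y hx hy z hz => ?_)
    · rw [algebraMap_smul]; exact S.smul_mem s hx
    · rw [add_smul]; exact S.add_mem (hx hz) (hy hz)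
    · rw [mul_smul]; exact hx (hy hz)

/-- A `𝕜`-linear map commuting with `E`, `b`, `c`, `d` is `H`-linear. -/
def equivariantMap (f : M →ₗ[𝕜] N) (fE : ∀ x, f (hE 𝕜 m n ξ • x) = hE 𝕜 m n ξ • f x)
    (f_b : ∀ x, f ((hb : H 𝕜 m n ξ) • x) = (hb : H 𝕜 m n ξ) • f x)
    (f_c : ∀ x, f ((hc : H 𝕜 m n ξ) • x) = (hc : H 𝕜 m n ξ) • f x)
    (f_d : ∀ x, f ((hd : H 𝕜 m n ξ) • x) = (hd : H 𝕜 m n ξ) • f x) : M →ₗ[H 𝕜 m n ξ] N where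
  __ := f.toAddHom
  map_smul' := by
    refine shifted_induction (fun s x => ?_) fE f_b f_c f_d (fun x y hx hy z => ?_)
      (fun x y hx hy z => ?_)
    · simp [algebraMap_smul]
    · simp_all [add_smul]
    · simp_all [mul_smul]

@[simp]
theorem equivariantMap_apply {f : M →ₗ[𝕜] N} {fE f_b f_c f_d} {x : M} :
    equivariantMap (n := n) (ξ := ξ) (m := m) f fE f_b f_c f_d x = f x := rfl

end Stable

end Presentation

section Coefficients

variable {K : Type*} [Field K] {q β y : K}

/-- The scalar `∑_{i ≤ k} (qⁱ β - q⁻ⁱ y)` in closed form; it is the coefficient of `Fᵏ p` in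
`E Fᵏ⁺¹ p` for a highest weight vector `p`. -/
def coef (q β y : K) (k : ℕ) : K := (1 - q)⁻¹ * (1 - q ^ (k + 1)) * (β - (q⁻¹) ^ k * y)

theorem coef_zero (hq1 : q ≠ 1) : coef q β y 0 = β - y := by
  rw [coef, zero_add, pow_one, pow_zero, one_mul, inv_mul_cancel₀ (sub_ne_zero.2 hq1.symm), one_mul]

theorem coef_succ (hq0 : q ≠ 0) (hq1 : q ≠ 1) (k : ℕ) :
    coef q β y (k + 1) = coef q β y k + (q ^ (k + 1) * β - (q⁻¹) ^ (k + 1) * y) := by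
  have h1 : (1 - q) ≠ 0 := sub_ne_zero.2 hq1.symm
  simp only [coef, inv_pow]
  field_simp
  ring

theorem coef_eq_zero_of_pow_eq_one {k : ℕ} (h : q ^ (k + 1) = 1) : coef q β y k = 0 := by
  simp [coef, h]

theorem coef_ne_zero {n k : ℕ} (hq : IsPrimitiveRoot q n) (hk : k + 1 < n)
    (h : β ≠ (q⁻¹) ^ k * y) : coef q β y k ≠ 0 := by
  have h1 : q ≠ 1 := by
    simpa using hq.pow_ne_one_of_pos_of_lt (l := 1) one_ne_zero (by omega)
  have h2 := hq.pow_ne_one_of_pos_of_lt (l := k + 1) (by omega) hk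
  exact mul_ne_zero (mul_ne_zero (inv_ne_zero (sub_ne_zero.2 h1.symm)) (sub_ne_zero.2 h2.symm))
    (sub_ne_zero.2 h)

section Resonant

variable {n s r : ℕ}

theorem coef_resonant (hq0 : q ≠ 0) : coef q β (q ^ s * β) s = 0 := by
  rw [coef, inv_pow, inv_mul_cancel_left₀ (pow_ne_zero s hq0), sub_self, mul_zero]

theorem coef_shift (hq0 : q ≠ 0) (k : ℕ) :
    coef q (q ^ (s + 1) * β) (q⁻¹ * β) k = coef q β (q ^ s * β) (s + 1 + k) := by
  by_cases hq1 : 1 - q = 0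
  · simp [coef, hq1]
  simp only [coef, inv_pow]
  field_simp
  ring

theorem coef_resonant_ne_zero (hβ : β ≠ 0) (hq : IsPrimitiveRoot q n) {k : ℕ} (hk : k + 1 < n)
    (hs : s < n) (hks : k ≠ s) : coef q β (q ^ s * β) k ≠ 0 := by
  refine coef_ne_zero hq hk fun h => hks ?_
  have hq0 : q ≠ 0 := hq.ne_zero (by omega)
  rw [inv_pow, eq_inv_mul_iff_mul_eq₀ (pow_ne_zero k hq0)] at h
  exact hq.pow_inj (by omega) hs (mul_right_cancel₀ hβ h)

theorem coef_shift_ne_zero (hβ : β ≠ 0) (hq : IsPrimitiveRoot q n) (hn : n = s + r + 2) {k : ℕ}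
    (hk : k + 1 < n) (hkr : k ≠ r) : coef q (q ^ (s + 1) * β) (q⁻¹ * β) k ≠ 0 := by
  refine coef_ne_zero hq hk fun h => hkr ?_
  have hq0 : q ≠ 0 := hq.ne_zero (by omega)
  rw [inv_pow, eq_inv_mul_iff_mul_eq₀ (pow_ne_zero k hq0), eq_inv_mul_iff_mul_eq₀ hq0, ← mul_assoc,
    ← mul_assoc, ← pow_succ', ← pow_add, mul_eq_right₀ hβ, hq.pow_eq_one_iff_dvd] at h
  obtain ⟨t, ht⟩ := h
  have : t < 2 := by
    by_contra h2
    have : n * 2 ≤ n * t := Nat.mul_le_mul_left n (by omega)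
    omega
  interval_cases t <;> omega

end Resonant

end Coefficients

section Chain

variable {𝕜} {R X : Type*} [Ring R] [AddCommGroup X] [Module 𝕜 X] [Module R X]
  [SMulCommClass R 𝕜 X]

theorem pow_smul_chain {a : R} {u : ℕ → X} {t : ℕ → 𝕜} (h : ∀ k, a • u (k + 1) = t k • u k)
    (i j : ℕ) : a ^ j • u (i + j) = (∏ k ∈ Finset.range j, t (i + k)) • u i := by
  induction j with
  | zero => simp
  | succ j ih =>
    rw [pow_succ, mul_smul, ← add_assoc, h, smul_comm, ih, smul_smul, Finset.prod_range_succ,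
      mul_comm]

theorem pow_smul_shift {a : R} {u : ℕ → X} (h : ∀ k, a • u k = u (k + 1)) (i j : ℕ) :
    a ^ j • u i = u (i + j) := by
  induction j with
  | zero => simp
  | succ j ih => rw [pow_succ', mul_smul, ih, h, add_assoc]

end Chain

section Weights

variable {𝕜 m n ξ} {M : Type*} [AddCommGroup M] [Module 𝕜 M] [Module (H 𝕜 m n ξ) M]
  [IsScalarTower 𝕜 (H 𝕜 m n ξ) M]

variable (m n ξ) in
/-- `p` is a weight vector: `b p = β p` and `c p = γ p`. -/
structure IsWt (β γ : 𝕜) (p : M) : Prop where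
  b : (hb : H 𝕜 m n ξ) • p = β • p
  c : (hc : H 𝕜 m n ξ) • p = γ • p

variable {β γ : 𝕜} {p : M}

theorem IsWt.c_pow (h : IsWt m n ξ β γ p) (k : ℕ) : (hc : H 𝕜 m n ξ) ^ k • p = γ ^ k • p := by
  induction k with
  | zero => simp
  | succ k ih => rw [pow_succ, mul_smul, h.c, smul_comm, ih, smul_smul, pow_succ']

theorem IsWt.b_pow (h : IsWt m n ξ β γ p) (k : ℕ) : (hb : H 𝕜 m n ξ) ^ k • p = β ^ k • p := by
  induction k with
  | zero => simp
  | succ k ih => rw [pow_succ, mul_smul, h.b, smul_comm, ih, smul_smul, pow_succ']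

theorem IsWt.b_root (h : IsWt m n ξ β γ p) (hp : p ≠ 0) : β ^ (m * n) = 1 := by
  have := h.b_pow (m * n)
  rw [gen_b_pow, one_smul] at this
  exact smul_left_injective 𝕜 hp (by simpa using this.symm)

theorem IsWt.c_root (h : IsWt m n ξ β γ p) (hp : p ≠ 0) : γ ^ (m * n) = 1 := by
  have := h.c_pow (m * n)
  rw [gen_c_pow, one_smul] at this
  exact smul_left_injective 𝕜 hp (by simpa using this.symm)

variable (hm : 1 < m) (hn : 1 < n) (hξ : IsPrimitiveRoot ξ (m * n))
include hm hn hξ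

theorem IsWt.F (h : IsWt m n ξ β γ p) :
    IsWt m n ξ (ξ ^ m * β) (ξ⁻¹ * γ) ((hd : H 𝕜 m n ξ) • p) where
  b := by
    rw [← mul_smul, (shiftedRel_gen hm hn hξ).bF, smul_assoc, mul_smul, h.b, smul_comm _ β,
      smul_smul]
  c := by
    rw [← mul_smul, qcomm_symm (root_ne_zero hm hn hξ) (shiftedRel_gen hm hn hξ).Fc, smul_assoc,
      mul_smul, h.c, smul_comm _ γ, smul_smul]

theorem IsWt.E (h : IsWt m n ξ β γ p) :
    IsWt m n ξ ((ξ ^ m)⁻¹ * β) (ξ * γ) (hE 𝕜 m n ξ • p) where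
  b := by
    rw [← mul_smul, qcomm_symm (pow_ne_zero m (root_ne_zero hm hn hξ))
      (shiftedRel_gen hm hn hξ).Eb, smul_assoc, mul_smul, h.b, smul_comm _ β, smul_smul]
  c := by
    rw [← mul_smul, qcomm_symm (inv_ne_zero (root_ne_zero hm hn hξ))
      (shiftedRel_gen hm hn hξ).Ec, smul_assoc, mul_smul, h.c, smul_comm _ γ, smul_smul, inv_inv]

theorem IsWt.pow_F (h : IsWt m n ξ β γ p) (k : ℕ) :
    IsWt m n ξ ((ξ ^ m) ^ k * β) ((ξ⁻¹) ^ k * γ) ((hd : H 𝕜 m n ξ) ^ k • p) := by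
  induction k with
  | zero => simpa using h
  | succ k ih =>
    rw [pow_succ', mul_assoc, pow_succ', mul_assoc, pow_succ', mul_smul]
    exact ih.F hm hn hξ

theorem IsWt.pow_E (h : IsWt m n ξ β γ p) (k : ℕ) :
    IsWt m n ξ (((ξ ^ m)⁻¹) ^ k * β) (ξ ^ k * γ) (hE 𝕜 m n ξ ^ k • p) := by
  induction k with
  | zero => simpa using h
  | succ k ih =>
    rw [pow_succ', mul_assoc, pow_succ', mul_assoc, pow_succ', mul_smul]
    exact ih.E hm hn hξ

theorem IsWt.E_F (h : IsWt m n ξ β γ p) : hE 𝕜 m n ξ • (hd : H 𝕜 m n ξ) • p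
    = (hd : H 𝕜 m n ξ) • hE 𝕜 m n ξ • p + (β - γ ^ m) • p := by
  rw [← mul_smul, (shiftedRel_gen hm hn hξ).EF, add_smul, mul_smul, sub_smul, h.b, h.c_pow,
    sub_smul]

theorem q_ne_one : ξ ^ m ≠ 1 := by
  simpa using (isPrimitiveRoot_q hm hn hξ).pow_ne_one_of_pos_of_lt (l := 1) one_ne_zero hn

theorem IsWt.E_pow_F (h : IsWt m n ξ β γ p) (k : ℕ) :
    hE 𝕜 m n ξ • (hd : H 𝕜 m n ξ) ^ (k + 1) • p
      = (hd : H 𝕜 m n ξ) ^ (k + 1) • hE 𝕜 m n ξ • p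
        + coef (ξ ^ m) β (γ ^ m) k • (hd : H 𝕜 m n ξ) ^ k • p := by
  have h1 := q_ne_one hm hn hξ
  have h0 := pow_ne_zero m (root_ne_zero hm hn hξ)
  induction k with
  | zero => rw [zero_add, pow_one, h.E_F hm hn hξ, coef_zero h1, pow_zero, one_smul]
  | succ k ih =>
    have hF : ∀ x : M, (hd : H 𝕜 m n ξ) ^ (k + 2) • x = hd • (hd : H 𝕜 m n ξ) ^ (k + 1) • x :=
      fun x => by rw [pow_succ' _ (k + 1), mul_smul]
    rw [hF, (h.pow_F hm hn hξ (k + 1)).E_F hm hn hξ, ih, smul_add, ← hF, coef_succ h0 h1,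
      mul_pow, pow_right_comm ξ⁻¹, inv_pow ξ m, smul_comm hd,
      ← mul_smul hd, ← pow_succ', add_smul, add_assoc]

end Weights

section Model

variable {𝕜} {X : Type*} [AddCommGroup X] [Module 𝕜 X] {n}

/-- The left basis vectors of a basis indexed by `Fin n ⊕ Fin n`, extended by zero to `ℕ`. -/
def vecL (B : Module.Basis (Fin n ⊕ Fin n) 𝕜 X) (k : ℕ) : X :=
  if h : k < n then B (.inl ⟨k, h⟩) else 0

/-- The right basis vectors of a basis indexed by `Fin n ⊕ Fin n`, extended by zero to `ℕ`. -/
def vecR (B : Module.Basis (Fin n ⊕ Fin n) 𝕜 X) (k : ℕ) : X :=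
  if h : k < n then B (.inr ⟨k, h⟩) else 0

variable {B : Module.Basis (Fin n ⊕ Fin n) 𝕜 X}

theorem vecL_of_le {k : ℕ} (h : n ≤ k) : vecL B k = 0 := dif_neg (by omega)

theorem vecR_of_le {k : ℕ} (h : n ≤ k) : vecR B k = 0 := dif_neg (by omega)

theorem linearMap_ext_vec {Y : Type*} [AddCommGroup Y] [Module 𝕜 Y] {f g : X →ₗ[𝕜] Y}
    (hL : ∀ k, f (vecL B k) = g (vecL B k)) (hR : ∀ k, f (vecR B k) = g (vecR B k)) : f = g := by
  refine B.ext ?_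
  rintro (k | k)
  · simpa [vecL] using hL k
  · simpa [vecR] using hR k

/-- The linear map with prescribed values on the basis vectors. -/
def vecMap {Y : Type*} [AddCommGroup Y] [Module 𝕜 Y] (B : Module.Basis (Fin n ⊕ Fin n) 𝕜 X)
    (u v : ℕ → Y) : X →ₗ[𝕜] Y :=
  B.constr 𝕜 (Sum.elim (fun k => u k) (fun k => v k))

section

variable {Y : Type*} [AddCommGroup Y] [Module 𝕜 Y] {u v : ℕ → Y}

theorem vecMap_vecL (hu : ∀ k, n ≤ k → u k = 0) (k : ℕ) : vecMap B u v (vecL B k) = u k := by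
  by_cases h : k < n
  · simp [vecL, h, vecMap]
  · rw [vecL_of_le (by omega), map_zero, hu k (by omega)]

theorem vecMap_vecR (hv : ∀ k, n ≤ k → v k = 0) (k : ℕ) : vecMap B u v (vecR B k) = v k := by
  by_cases h : k < n
  · simp [vecR, h, vecMap]
  · rw [vecR_of_le (by omega), map_zero, hv k (by omega)]

end

variable {m ξ} [Module (H 𝕜 m n ξ) X]

variable (m ξ) in
/-- `X` with the basis `B` realizes the standard indecomposable projective module of dimension
`2n`, described by the actions of `E`, `b`, `c`, `d` on the basis vectors. -/
structure IsModel (s r : ℕ) (β γ : 𝕜) (B : Module.Basis (Fin n ⊕ Fin n) 𝕜 X) : Prop where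
  F_L : ∀ k, (hd : H 𝕜 m n ξ) • vecL B k = vecL B (k + 1)
  F_R : ∀ k, (hd : H 𝕜 m n ξ) • vecR B k = vecR B (k + 1)
  E_L_zero : hE 𝕜 m n ξ • vecL B 0 = vecR B r
  E_L_succ : ∀ k, hE 𝕜 m n ξ • vecL B (k + 1)
    = coef (ξ ^ m) β ((ξ ^ m) ^ s * β) k • vecL B k + vecR B (r + 1 + k)
  E_R_zero : hE 𝕜 m n ξ • vecR B 0 = 0
  E_R_succ : ∀ k, hE 𝕜 m n ξ • vecR B (k + 1)
    = coef (ξ ^ m) ((ξ ^ m) ^ (s + 1) * β) ((ξ ^ m)⁻¹ * β) k • vecR B k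
  wt_L : ∀ k, IsWt m n ξ ((ξ ^ m) ^ k * β) (ξ⁻¹ ^ k * γ) (vecL B k)
  wt_R : ∀ k, IsWt m n ξ ((ξ ^ m) ^ (s + 1 + k) * β) (ξ⁻¹ ^ k * (ξ ^ (r + 1) * γ)) (vecR B k)

end Model

section Existence

variable {𝕜 m n ξ} {X : Type*} [AddCommGroup X] [Module 𝕜 X]

theorem exists_module_of_shiftedRel {E b c F : Module.End 𝕜 X} (hξ : ξ ≠ 0)
    (hq : (ξ ^ m) ^ n = 1) (hn : 1 < n) (h : ShiftedRel m n ξ E b c F)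
    (h_a : (E - shiftTerm m n ξ b c F) ^ n = b ^ n - 1) (h_b : b ^ (m * n) = 1)
    (h_c : c ^ (m * n) = 1) :
    ∃ (_ : Module (H 𝕜 m n ξ) X) (_ : IsScalarTower 𝕜 (H 𝕜 m n ξ) X),
      (∀ x : X, hE 𝕜 m n ξ • x = E x) ∧ (∀ x : X, (hb : H 𝕜 m n ξ) • x = b x) ∧
      (∀ x : X, (hc : H 𝕜 m n ξ) • x = c x) ∧ ∀ x : X, (hd : H 𝕜 m n ξ) • x = F x := by
  have hD := h.unshifted hξ hq hn
  let f : FreeAlgebra 𝕜 (Fin 4) →ₐ[𝕜] Module.End 𝕜 X :=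
    FreeAlgebra.lift 𝕜 ![E - shiftTerm m n ξ b c F, b, c, F]
  have f0 : f fa = E - shiftTerm m n ξ b c F := by simp [f, fgen]
  have f1 : f fb = b := by simp [f, fgen]
  have f2 : f fc = c := by simp [f, fgen]
  have f3 : f fd = F := by simp [f, fgen]
  have hf : ∀ ⦃x y⦄, HRel 𝕜 m n ξ x y → f x = f y := by
    intro x y hxy
    cases hxy <;> simp only [map_mul, map_pow, map_sub, map_add, map_smul, map_one, map_zero,
      f0, f1, f2, f3]
    exacts [h_a, h_b, h_c, hD.dPow, hD.ab, hD.dc, hD.bc, hD.bd, hD.ad, hD.ac]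
  let φ : H 𝕜 m n ξ →ₐ[𝕜] Module.End 𝕜 X := RingQuot.liftAlgHom 𝕜 ⟨f, hf⟩
  have hφ : ∀ k, φ (gen 𝕜 m n ξ k) = f (fgen 𝕜 k) := fun k =>
    RingQuot.liftAlgHom_mkAlgHom_apply 𝕜 f hf _
  let inst : Module (H 𝕜 m n ξ) X := Module.compHom X φ.toRingHom
  have hs : ∀ (a : H 𝕜 m n ξ) (x : X), a • x = φ a x := fun _ _ => rfl
  refine ⟨inst, ⟨fun t a x => ?_⟩, fun x => ?_, fun x => ?_, fun x => ?_, fun x => ?_⟩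
  · rw [hs, hs, map_smul, LinearMap.smul_apply]
  · rw [hs, hE, map_add, shiftTerm]
    simp only [map_mul, map_pow, map_sub, map_smul, hφ, f0, f1, f2, f3]
    simp [shiftTerm]
  · rw [hs, hφ, f1]
  · rw [hs, hφ, f2]
  · rw [hs, hφ, f3]

theorem DrinfeldRel.pow_a_mul_d {R : Type*} [Ring R] [Algebra 𝕜 R] {a b c d : R}
    (h : DrinfeldRel m n ξ a b c d) (hg : a * c ^ m = (ξ ^ m)⁻¹ • (c ^ m * a)) (k : ℕ) :
    a ^ (k + 1) * d = d * a ^ (k + 1) + ((∑ i ∈ Finset.range (k + 1), (ξ ^ m) ^ i) • b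
      - (∑ i ∈ Finset.range (k + 1), ((ξ ^ m)⁻¹) ^ i) • c ^ m) * a ^ k := by
  have had : a * d = d * a + (b - c ^ m) := by rw [← h.ad]; abel
  induction k with
  | zero => simp [had]
  | succ k ih =>
    have hS : ∀ x : 𝕜, ∑ i ∈ Finset.range (k + 2), x ^ i
        = x * ∑ i ∈ Finset.range (k + 1), x ^ i + 1 := fun x => by
      rw [Finset.sum_range_succ', Finset.mul_sum, pow_zero]
      simp only [pow_succ']
    have hb' : ∀ (S : 𝕜) (z : R), a * (S • b * z) = (ξ ^ m * S) • b * (a * z) := fun S z => by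
      rw [← mul_assoc, mul_smul_comm, h.ab, smul_smul, mul_comm S, smul_mul_assoc, smul_mul_assoc,
        mul_assoc]
    have hc' : ∀ (S : 𝕜) (z : R), a * (S • c ^ m * z) = ((ξ ^ m)⁻¹ * S) • c ^ m * (a * z) :=
      fun S z => by
        rw [← mul_assoc, mul_smul_comm, hg, smul_smul, mul_comm S, smul_mul_assoc, smul_mul_assoc,
          mul_assoc]
    rw [hS, hS, pow_succ' a (k + 1), mul_assoc, ih, sub_mul, mul_add, mul_sub, hb', hc',
      ← pow_succ', ← mul_assoc a d, had, add_smul, add_smul, one_smul, one_smul]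
    simp only [add_mul, sub_mul, mul_assoc, ← pow_succ']
    abel

theorem exists_isModel (hm : 1 < m) (hn : 1 < n) (hξ : IsPrimitiveRoot ξ (m * n)) {s r : ℕ}
    (hsr : n = s + r + 2) {β γ : 𝕜} (hβ : β ^ n = 1) (hγ : γ ^ (m * n) = 1)
    (hβγ : γ ^ m = (ξ ^ m) ^ s * β) (B : Module.Basis (Fin n ⊕ Fin n) 𝕜 X) :
    ∃ (_ : Module (H 𝕜 m n ξ) X) (_ : IsScalarTower 𝕜 (H 𝕜 m n ξ) X), IsModel m ξ s r β γ B := by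
  have h0 := root_ne_zero hm hn hξ
  have hq := isPrimitiveRoot_q hm hn hξ
  have hq1 := q_ne_one hm hn hξ
  have hq0 := pow_ne_zero m h0
  let cL : ℕ → 𝕜 := coef (ξ ^ m) β ((ξ ^ m) ^ s * β)
  let cR : ℕ → 𝕜 := coef (ξ ^ m) ((ξ ^ m) ^ (s + 1) * β) ((ξ ^ m)⁻¹ * β)
  have cLR : ∀ k, cR k = cL (s + 1 + k) := coef_shift hq0
  have cL0 : cL (n - 1) = 0 :=
    coef_eq_zero_of_pow_eq_one (by rw [Nat.sub_add_cancel hn.le]; exact hq.pow_eq_one)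
  have cR0 : cR (n - 1) = 0 :=
    coef_eq_zero_of_pow_eq_one (by rw [Nat.sub_add_cancel hn.le]; exact hq.pow_eq_one)
  have cRr : cR r = 0 := by
    rw [cLR, show s + 1 + r = n - 1 by omega, cL0]
  have cLs : cL s = 0 := coef_resonant hq0
  let E : Module.End 𝕜 X := vecMap B
    (fun k => Nat.casesOn k (vecR B r) fun k => cL k • vecL B k + vecR B (r + 1 + k))
    (fun k => Nat.casesOn k 0 fun k => cR k • vecR B k)
  let F : Module.End 𝕜 X := vecMap B (fun k => vecL B (k + 1)) (fun k => vecR B (k + 1))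
  let b : Module.End 𝕜 X := vecMap B (fun k => ((ξ ^ m) ^ k * β) • vecL B k)
    (fun k => ((ξ ^ m) ^ (s + 1 + k) * β) • vecR B k)
  let c : Module.End 𝕜 X := vecMap B (fun k => (ξ⁻¹ ^ k * γ) • vecL B k)
    (fun k => (ξ⁻¹ ^ k * (ξ ^ (r + 1) * γ)) • vecR B k)
  have zL : ∀ k, n - 1 ≤ k → cL k • vecL B k + vecR B (r + 1 + k) = 0 := by
    intro k hk
    rw [vecR_of_le (by omega), add_zero]
    obtain rfl | hk := hk.eq_or_lt
    · rw [cL0, zero_smul]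
    · rw [vecL_of_le (by omega), smul_zero]
  have zR : ∀ k, n - 1 ≤ k → cR k • vecR B k = 0 := by
    intro k hk
    obtain rfl | hk := hk.eq_or_lt
    · rw [cR0, zero_smul]
    · rw [vecR_of_le (by omega), smul_zero]
  have FL : ∀ k, F (vecL B k) = vecL B (k + 1) := vecMap_vecL fun k hk => vecL_of_le (by omega)
  have FR : ∀ k, F (vecR B k) = vecR B (k + 1) := vecMap_vecR fun k hk => vecR_of_le (by omega)
  have zEL : ∀ k, n ≤ k → (fun k => Nat.casesOn (motive := fun _ => X) k (vecR B r)
      fun k => cL k • vecL B k + vecR B (r + 1 + k)) k = 0 := by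
    rintro (_ | k) hk
    · omega
    · exact zL k (by omega)
  have zER : ∀ k, n ≤ k → (fun k => Nat.casesOn (motive := fun _ => X) k 0
      fun k => cR k • vecR B k) k = 0 := by
    rintro (_ | k) hk
    · omega
    · exact zR k (by omega)
  have EL0 : E (vecL B 0) = vecR B r := vecMap_vecL zEL 0
  have EL : ∀ k, E (vecL B (k + 1)) = cL k • vecL B k + vecR B (r + 1 + k) := fun k =>
    vecMap_vecL zEL (k + 1)
  have ER0 : E (vecR B 0) = 0 := vecMap_vecR zER 0
  have ER : ∀ k, E (vecR B (k + 1)) = cR k • vecR B k := fun k => vecMap_vecR zER (k + 1)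
  have bL : ∀ k, b (vecL B k) = ((ξ ^ m) ^ k * β) • vecL B k :=
    vecMap_vecL fun k hk => by rw [vecL_of_le hk, smul_zero]
  have bR : ∀ k, b (vecR B k) = ((ξ ^ m) ^ (s + 1 + k) * β) • vecR B k :=
    vecMap_vecR fun k hk => by rw [vecR_of_le hk, smul_zero]
  have cL' : ∀ k, c (vecL B k) = (ξ⁻¹ ^ k * γ) • vecL B k :=
    vecMap_vecL fun k hk => by rw [vecL_of_le hk, smul_zero]
  have cR' : ∀ k, c (vecR B k) = (ξ⁻¹ ^ k * (ξ ^ (r + 1) * γ)) • vecR B k :=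
    vecMap_vecR fun k hk => by rw [vecR_of_le hk, smul_zero]
  have powe : ∀ (f : Module.End 𝕜 X) (x : X) (t : 𝕜) (_ : f x = t • x) (k : ℕ),
      (f ^ k) x = t ^ k • x := by
    intro f x t h k
    induction k with
    | zero => simp
    | succ k ih => rw [pow_succ, Module.End.mul_apply, h, map_smul, ih, smul_smul, pow_succ']
  have gL : ∀ k, (c ^ m) (vecL B k) = ((ξ ^ m)⁻¹ ^ k * ((ξ ^ m) ^ s * β)) • vecL B k := by
    intro k
    rw [powe _ _ _ (cL' k), mul_pow, hβγ, pow_right_comm, inv_pow ξ]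
  have gR : ∀ k, (c ^ m) (vecR B k) = ((ξ ^ m)⁻¹ ^ k * ((ξ ^ m)⁻¹ * β)) • vecR B k := by
    intro k
    have : (ξ ^ (r + 1)) ^ m * ((ξ ^ m) ^ s * β) = (ξ ^ m)⁻¹ * β := by
      rw [eq_inv_mul_iff_mul_eq₀ hq0, pow_right_comm, ← mul_assoc, ← mul_assoc, ← pow_succ',
        ← pow_add, show r + 1 + 1 + s = n by omega, hq.pow_eq_one, one_mul]
    rw [powe _ _ _ (cR' k), mul_pow, mul_pow, hβγ, this, pow_right_comm, inv_pow ξ]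
  have hqn : (ξ ^ m) ^ (s + r + 2) = 1 := by rw [← hsr, hq.pow_eq_one]
  have hξk : ∀ k, ξ⁻¹ ^ k * ξ ^ k = 1 := fun k => by
    rw [← mul_pow, inv_mul_cancel₀ h0, one_pow]
  have cL_zero : cL 0 = β - (ξ ^ m) ^ s * β := coef_zero hq1
  have cR_zero : cR 0 = (ξ ^ m) ^ (s + 1) * β - (ξ ^ m)⁻¹ * β := coef_zero hq1
  have cL_succ : ∀ k, cL (k + 1) = cL k +
      ((ξ ^ m) ^ (k + 1) * β - (ξ ^ m)⁻¹ ^ (k + 1) * ((ξ ^ m) ^ s * β)) := coef_succ hq0 hq1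
  have cR_succ : ∀ k, cR (k + 1) = cR k +
      ((ξ ^ m) ^ (k + 1) * ((ξ ^ m) ^ (s + 1) * β) - (ξ ^ m)⁻¹ ^ (k + 1) * ((ξ ^ m)⁻¹ * β)) :=
    coef_succ hq0 hq1
  have hqβ : ∀ k, ξ ^ m * ((ξ ^ m) ^ (s + 1 + (r + 1 + k)) * β) = (ξ ^ m) ^ (k + 1) * β := by
    intro k
    linear_combination (ξ ^ m) ^ (k + 1) * β * hqn
  have hrel : ShiftedRel m n ξ E b c F := by
    constructor
    · refine linearMap_ext_vec (B := B) ?_ ?_ <;> rintro (_ | k) <;>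
        simp only [Module.End.mul_apply, LinearMap.smul_apply, bL, bR, map_smul, map_add, map_zero,
          EL0, EL, ER0, ER, smul_smul, smul_zero, smul_add]
      · congr 1
        linear_combination -β * hqn
      · congr 2
        · ring
        · exact (hqβ k).symm
      · module
    · refine linearMap_ext_vec (B := B) ?_ ?_ <;> rintro (_ | k) <;>
        simp only [Module.End.mul_apply, LinearMap.smul_apply, cL', cR', map_smul, map_add,
          map_zero, EL0, EL, ER0, ER, smul_smul, smul_zero, smul_add]
      · congr 1
        linear_combination -γ * hξk (r + 1)
      · congr 2
        · ring
        · linear_combination -ξ⁻¹ ^ (k + 1) * γ * hξk (r + 1)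
      · congr 1
        ring
    · refine linearMap_ext_vec (B := B) ?_ ?_ <;> intro k <;>
        simp only [Module.End.mul_apply, LinearMap.smul_apply, cL', cR', map_smul, FL, FR,
          smul_smul] <;> congr 1
      · linear_combination -ξ⁻¹ ^ k * γ * hξk 1
      · linear_combination -ξ⁻¹ ^ k * (ξ ^ (r + 1) * γ) * hξk 1
    · refine linearMap_ext_vec (B := B) ?_ ?_ <;> intro k <;>
        simp only [Module.End.mul_apply, cL', cR', bL, bR, map_smul, smul_smul] <;> congr 1 <;> ring
    · refine linearMap_ext_vec (B := B) ?_ ?_ <;> intro k <;>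
        simp only [Module.End.mul_apply, LinearMap.smul_apply, bL, bR, map_smul, FL, FR,
          smul_smul] <;> congr 1 <;> ring
    · refine linearMap_ext_vec (B := B) ?_ ?_ <;> rintro (_ | k) <;>
        simp only [Module.End.mul_apply, LinearMap.add_apply, LinearMap.sub_apply, bL, bR, gL, gR,
          map_smul, map_add, map_zero, FL, FR, EL0, EL, ER0, ER]
      · rw [cL_zero]; module
      · rw [cL_succ, show r + 1 + (k + 1) = r + 1 + k + 1 by ring]; module
      · rw [cR_zero]; module
      · rw [cR_succ]
        match_scalars
        ring
    · refine linearMap_ext_vec (B := B) ?_ ?_ <;> intro k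
      · have := pow_smul_shift (a := F) (u := vecL B) FL k n
        rw [Module.End.smul_def] at this
        rw [this, vecL_of_le (by omega), LinearMap.zero_apply]
      · have := pow_smul_shift (a := F) (u := vecR B) FR k n
        rw [Module.End.smul_def] at this
        rw [this, vecR_of_le (by omega), LinearMap.zero_apply]
  have h_b : b ^ n = 1 := by
    refine linearMap_ext_vec (B := B) (fun k => ?_) (fun k => ?_)
    · rw [powe _ _ _ (bL k), mul_pow, hβ, pow_right_comm, hq.pow_eq_one]; simp
    · rw [powe _ _ _ (bR k), mul_pow, hβ, pow_right_comm, hq.pow_eq_one]; simp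
  have h_c : c ^ (m * n) = 1 := by
    have h1 : ∀ k, (ξ⁻¹ ^ k) ^ (m * n) = 1 := fun k => by
      rw [pow_right_comm, inv_pow, hξ.pow_eq_one, inv_one, one_pow]
    refine linearMap_ext_vec (B := B) (fun k => ?_) (fun k => ?_)
    · rw [powe _ _ _ (cL' k), mul_pow, hγ, h1]; simp
    · rw [powe _ _ _ (cR' k), mul_pow, mul_pow, hγ, h1, pow_right_comm, hξ.pow_eq_one]; simp
  have h_a : (E - shiftTerm m n ξ b c F) ^ n = 0 := by
    have hqinv : (ξ ^ m)⁻¹ ^ (n - 1) = ξ ^ m := by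
      rw [inv_pow]
      refine inv_eq_of_mul_eq_one_right ?_
      rw [← pow_succ, Nat.sub_add_cancel hn.le, hq.pow_eq_one]
    have hqinv' : (ξ ^ m) ^ (n - 1) = (ξ ^ m)⁻¹ := by
      rw [← inv_inj, ← inv_pow, hqinv, inv_inv]
    set D := shiftTerm m n ξ b c F with hD
    set a := E - D with h_def
    have hDrin : DrinfeldRel m n ξ a b c F := hrel.unshifted h0 hq.pow_eq_one hn
    have hg : a * c ^ m = (ξ ^ m)⁻¹ • (c ^ m * a) := by
      rw [h_def, sub_mul, qcomm_pow_right hrel.Ec,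
        qcomm_pow_right (shiftTerm_mul_c hrel.Fc hrel.bc), mul_sub, smul_sub, pow_right_comm,
        hqinv', inv_pow]
    have haF : a ^ n * F = F * a ^ n := by
      have := hDrin.pow_a_mul_d hg (n - 1)
      rwa [Nat.sub_add_cancel hn.le, hq.geom_sum_eq_zero hn, hq.inv.geom_sum_eq_zero hn, zero_smul,
        zero_smul, sub_zero, zero_mul, add_zero] at this
    have F_L : ∀ k, (F ^ (n - 1)) (vecL B k) = vecL B (k + (n - 1)) := fun k =>
      pow_smul_shift (a := F) (u := vecL B) FL k (n - 1)
    have F_R : ∀ k, (F ^ (n - 1)) (vecR B k) = vecR B (k + (n - 1)) := fun k =>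
      pow_smul_shift (a := F) (u := vecR B) FR k (n - 1)
    obtain ⟨δ, hδL, hδR⟩ : ∃ δ : 𝕜, D (vecL B 0) = δ • vecL B (n - 1) ∧
        D (vecR B 0) = -(δ • vecR B (n - 1)) := by
      refine ⟨(qFact 𝕜 (ξ ^ m) (n - 1))⁻¹ * ((ξ ^ m) ^ (s + 1) * β - β), ?_, ?_⟩
      · simp only [hD, shiftTerm, LinearMap.smul_apply, Module.End.mul_apply, LinearMap.sub_apply,
          F_L, gL, bL, zero_add, hqinv, hqinv']
        rw [smul_smul, mul_inv_cancel_left₀ hq0]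
        module
      · simp only [hD, shiftTerm, LinearMap.smul_apply, Module.End.mul_apply, LinearMap.sub_apply,
          F_R, gR, bR, zero_add, hqinv, pow_add _ (s + 1), hqinv']
        rw [smul_smul, mul_inv_cancel_left₀ hq0,
          show ξ ^ m * ((ξ ^ m) ^ (s + 1) * (ξ ^ m)⁻¹ * β) = (ξ ^ m) ^ (s + 1) * β by
            field_simp]
        module
    have hDL : ∀ k, D (vecL B (k + 1)) = 0 := fun k => by
      simp only [hD, shiftTerm, LinearMap.smul_apply, Module.End.mul_apply, F_L]
      rw [vecL_of_le (by omega), map_zero, smul_zero]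
    have hDR : ∀ k, D (vecR B (k + 1)) = 0 := fun k => by
      simp only [hD, shiftTerm, LinearMap.smul_apply, Module.End.mul_apply, F_R]
      rw [vecR_of_le (by omega), map_zero, smul_zero]
    have aR0 : a • vecR B 0 = δ • vecR B (n - 1) := by
      rw [Module.End.smul_def, h_def, LinearMap.sub_apply, ER0, hδR, zero_sub, neg_neg]
    have aR : ∀ k, a • vecR B (k + 1) = cR k • vecR B k := fun k => by
      rw [Module.End.smul_def, h_def, LinearMap.sub_apply, ER, hDR, sub_zero]
    have aL0 : a • vecL B 0 = vecR B r - δ • vecL B (n - 1) := by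
      rw [Module.End.smul_def, h_def, LinearMap.sub_apply, EL0, hδL]
    have aL : ∀ k, a • vecL B (k + 1) = cL k • vecL B k + vecR B (r + 1 + k) := fun k => by
      rw [Module.End.smul_def, h_def, LinearMap.sub_apply, EL, hDL, sub_zero]
    have chR := pow_smul_chain (a := a) aR 0
    have chL := pow_smul_chain (a := a) (u := fun k => vecL B (s + 1 + k))
      (t := fun k => cL (s + 1 + k)) (fun k => by
        rw [← add_assoc, aL, vecR_of_le (k := r + 1 + (s + 1 + k)) (by omega), add_zero]) 0
    have zR : a ^ n • vecR B 0 = 0 := by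
      have hsplit : a ^ n = a ^ (n - 1) * a := by rw [← pow_succ, Nat.sub_add_cancel hn.le]
      have := chR (n - 1)
      rw [zero_add] at this
      rw [hsplit, mul_smul, aR0, smul_comm, this,
        Finset.prod_eq_zero (i := r) (by rw [Finset.mem_range]; omega)
        (by rw [zero_add, cRr]), zero_smul, smul_zero]
    have zL : a ^ n • vecL B 0 = 0 := by
      have hsplit : a ^ n = a ^ s * (a * a ^ r) * a := by
        rw [← pow_succ', ← pow_add, ← pow_succ, hsr]; congr 1
      have hR := chR r
      have hL := chL r
      rw [zero_add] at hR
      simp only [zero_add, add_zero] at hL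
      have hLn : vecL B (n - 1) = vecL B (s + 1 + r) := by congr 1; omega
      have hRn : vecR B (n - 1) = vecR B (r + 1 + s) := by congr 1; omega
      have hprod : ∏ k ∈ Finset.range r, cR (0 + k) = ∏ k ∈ Finset.range r, cL (s + 1 + k) :=
        Finset.prod_congr rfl fun k _ => by rw [zero_add, cLR]
      rw [hsplit, mul_smul, aL0, mul_smul, mul_smul, smul_sub, smul_sub, hR, smul_comm _ δ, hLn, hL,
        smul_comm _ _ (vecR B 0), aR0, smul_comm a, smul_comm a, aL, cLs, zero_smul, zero_add,
        ← hRn, hprod, smul_comm _ δ, sub_self, smul_zero]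
    have haFk : ∀ k (x : X), (a ^ n) ((F ^ k) x) = (F ^ k) ((a ^ n) x) := fun k x => by
      rw [← Module.End.mul_apply, ← Module.End.mul_apply,
        ((show Commute (a ^ n) F from haF).pow_right k).eq]
    refine linearMap_ext_vec (B := B) (fun k => ?_) (fun k => ?_)
    · have := pow_smul_shift (a := F) (u := vecL B) FL 0 k
      rw [zero_add, Module.End.smul_def] at this
      rw [← this, haFk, ← Module.End.smul_def (a ^ n), zL, map_zero, LinearMap.zero_apply]
    · have := pow_smul_shift (a := F) (u := vecR B) FR 0 k
      rw [zero_add, Module.End.smul_def] at this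
      rw [← this, haFk, ← Module.End.smul_def (a ^ n), zR, map_zero, LinearMap.zero_apply]
  obtain ⟨inst, tower, hE', hb', hc', hd'⟩ := exists_module_of_shiftedRel h0 hq.pow_eq_one hn hrel
    (by rw [h_a, h_b, sub_self]) (by rw [mul_comm m, pow_mul, h_b, one_pow]) h_c
  refine ⟨inst, tower, ?_⟩
  constructor
  · intro k; rw [hd', FL]
  · intro k; rw [hd', FR]
  · rw [hE', EL0]
  · intro k; rw [hE', EL]
  · rw [hE', ER0]
  · intro k; rw [hE', ER]
  · intro k; exact ⟨by rw [hb', bL], by rw [hc', cL']⟩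
  · intro k; exact ⟨by rw [hb', bR], by rw [hc', cR']⟩

end Existence

section WeightProjector

variable {𝕜} in
/-- The idempotent projecting onto the `μ`-eigenspace of an element `g` with `g ^ N = 1`. -/
def eigenProj {R : Type*} [Ring R] [Algebra 𝕜 R] (N : ℕ) (g : R) (μ : 𝕜) : R :=
  (N : 𝕜)⁻¹ • ∑ j ∈ Finset.range N, μ⁻¹ ^ j • g ^ j

variable {𝕜} {R M : Type*} [Ring R] [Algebra 𝕜 R] [AddCommGroup M] [Module 𝕜 M] [Module R M]
  [IsScalarTower 𝕜 R M] {N : ℕ} {g : R} {μ ν : 𝕜} {x : M}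

theorem pow_smul_of_eigen (hx : g • x = ν • x) (j : ℕ) : g ^ j • x = ν ^ j • x := by
  induction j with
  | zero => simp
  | succ j ih => rw [pow_succ, mul_smul, hx, smul_algebra_smul_comm, ih, smul_smul, pow_succ']

theorem eigenProj_smul (hx : g • x = ν • x) :
    eigenProj N g μ • x = ((N : 𝕜)⁻¹ * ∑ j ∈ Finset.range N, (μ⁻¹ * ν) ^ j) • x := by
  simp only [eigenProj, smul_assoc, Finset.sum_smul, pow_smul_of_eigen hx, smul_smul, ← mul_pow,
    mul_smul]

theorem eigenProj_smul_self (hN : (N : 𝕜) ≠ 0) (hμ : μ ≠ 0) (hx : g • x = μ • x) :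
    eigenProj N g μ • x = x := by
  rw [eigenProj_smul hx, inv_mul_cancel₀ hμ]
  simp [hN]

theorem eigenProj_smul_of_ne (hμ : μ ^ N = 1) (hν : ν ^ N = 1) (hμν : ν ≠ μ)
    (hx : g • x = ν • x) : eigenProj N g μ • x = 0 := by
  have h0 : μ⁻¹ * ν ≠ 1 := fun h => hμν (by
    have hμ0 : μ ≠ 0 := by rintro rfl; simp at h
    rwa [inv_mul_eq_one₀ hμ0, eq_comm] at h)
  rw [eigenProj_smul hx, geom_sum_eq h0, mul_pow, inv_pow, hμ, hν]
  simp

theorem mul_eigenProj (hN : N ≠ 0) (hμ : μ ^ N = 1) (hg : g ^ N = 1) :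
    g * eigenProj N g μ = μ • eigenProj N g μ := by
  have hμ0 : μ ≠ 0 := by rintro rfl; simp [hN] at hμ
  have h1 : ∀ j, g * (μ⁻¹ ^ j • g ^ j) = μ • (μ⁻¹ ^ (j + 1) • g ^ (j + 1)) := fun j => by
    rw [mul_smul_comm, ← pow_succ', pow_succ' μ⁻¹, mul_smul, smul_inv_smul₀ hμ0]
  have h2 : ∑ j ∈ Finset.range N, μ⁻¹ ^ (j + 1) • g ^ (j + 1)
      = ∑ j ∈ Finset.range N, μ⁻¹ ^ j • g ^ j := by
    have h := Finset.sum_range_succ' (fun j => μ⁻¹ ^ j • g ^ j) N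
    rw [Finset.sum_range_succ, inv_pow, hμ, hg, inv_one, pow_zero, pow_zero] at h
    exact (add_right_cancel h).symm
  rw [eigenProj, mul_smul_comm, smul_comm μ, Finset.mul_sum, Finset.sum_congr rfl fun j _ => h1 j,
    ← Finset.smul_sum, h2]

end WeightProjector

section Coordinates

variable {𝕜 n} {X : Type*} [AddCommGroup X] [Module 𝕜 X]

/-- The coordinate functional dual to `vecL B k`. -/
def coL (B : Module.Basis (Fin n ⊕ Fin n) 𝕜 X) (k : ℕ) : X →ₗ[𝕜] 𝕜 :=
  if h : k < n then B.coord (.inl ⟨k, h⟩) else 0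

/-- The coordinate functional dual to `vecR B k`. -/
def coR (B : Module.Basis (Fin n ⊕ Fin n) 𝕜 X) (k : ℕ) : X →ₗ[𝕜] 𝕜 :=
  if h : k < n then B.coord (.inr ⟨k, h⟩) else 0

variable {B : Module.Basis (Fin n ⊕ Fin n) 𝕜 X}

theorem coL_vecL (j k : ℕ) : coL B j (vecL B k) = if j = k ∧ k < n then 1 else 0 := by
  by_cases hj : j < n <;> by_cases hk : k < n <;>
    simp [coL, vecL, hj, hk, Finsupp.single_apply, eq_comm]
  omega

theorem coR_vecR (j k : ℕ) : coR B j (vecR B k) = if j = k ∧ k < n then 1 else 0 := by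
  by_cases hj : j < n <;> by_cases hk : k < n <;>
    simp [coR, vecR, hj, hk, Finsupp.single_apply, eq_comm]
  omega

theorem coL_vecR (j k : ℕ) : coL B j (vecR B k) = 0 := by
  by_cases hj : j < n <;> by_cases hk : k < n <;> simp [coL, vecR, hj, hk]

theorem coR_vecL (j k : ℕ) : coR B j (vecL B k) = 0 := by
  by_cases hj : j < n <;> by_cases hk : k < n <;> simp [coR, vecL, hj, hk]

theorem coL_of_le {k : ℕ} (h : n ≤ k) : coL B k = 0 := dif_neg (by omega)

theorem coR_of_le {k : ℕ} (h : n ≤ k) : coR B k = 0 := dif_neg (by omega)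

theorem sum_vec (p : X) : ∑ k ∈ Finset.range n, coL B k p • vecL B k
    + ∑ k ∈ Finset.range n, coR B k p • vecR B k = p := by
  conv_rhs => rw [← B.sum_repr p]
  rw [Fintype.sum_sum_type, Finset.sum_range, Finset.sum_range]
  simp [coL, coR, vecL, vecR]

end Coordinates

section Diamond

variable {𝕜 m n ξ} {X : Type*} [AddCommGroup X] [Module 𝕜 X] [Module (H 𝕜 m n ξ) X]
  [IsScalarTower 𝕜 (H 𝕜 m n ξ) X] {B : Module.Basis (Fin n ⊕ Fin n) 𝕜 X} {s r : ℕ} {β γ : 𝕜}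

theorem smul_mem_cancel {N : Submodule (H 𝕜 m n ξ) X} {t : 𝕜} (ht : t ≠ 0) {x : X}
    (h : t • x ∈ N) : x ∈ N := by
  have := N.smul_of_tower_mem t⁻¹ h
  rwa [inv_smul_smul₀ ht] at this

theorem mem_of_vec_mem {N : Submodule (H 𝕜 m n ξ) X} {p : X}
    (hL : ∀ k, coL B k p ≠ 0 → vecL B k ∈ N) (hR : ∀ k, coR B k p ≠ 0 → vecR B k ∈ N) :
    p ∈ N := by
  rw [← sum_vec (B := B) p]
  refine N.add_mem (sum_mem fun k _ => ?_) (sum_mem fun k _ => ?_)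
  · by_cases h : coL B k p = 0
    · rw [h, zero_smul]; exact N.zero_mem
    · exact N.smul_of_tower_mem _ (hL k h)
  · by_cases h : coR B k p = 0
    · rw [h, zero_smul]; exact N.zero_mem
    · exact N.smul_of_tower_mem _ (hR k h)

theorem exists_coord_ne_zero {p : X} (hp : p ≠ 0) :
    (∃ k, coL B k p ≠ 0) ∨ ∃ k, coR B k p ≠ 0 := by
  by_contra! h
  exact hp ((sum_vec (B := B) p).symm.trans (by simp [h.1, h.2]))

variable (hm : 1 < m) (hn : 1 < n) (hξ : IsPrimitiveRoot ξ (m * n)) (hsr : n = s + r + 2)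

namespace IsModel

variable (hB : IsModel m ξ s r β γ B) {N : Submodule (H 𝕜 m n ξ) X}

section Ladder

include hB

omit [IsScalarTower 𝕜 (H 𝕜 m n ξ) X] in
theorem vecL_add_mem {k : ℕ} (h : vecL B k ∈ N) (j : ℕ) : vecL B (k + j) ∈ N := by
  rw [← pow_smul_shift hB.F_L]
  exact N.smul_mem _ h

omit [IsScalarTower 𝕜 (H 𝕜 m n ξ) X] in
theorem vecR_add_mem {k : ℕ} (h : vecR B k ∈ N) (j : ℕ) : vecR B (k + j) ∈ N := by
  rw [← pow_smul_shift hB.F_R]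
  exact N.smul_mem _ h

include hm hn hξ hsr

theorem vecR_mem_of_add (hβ : β ≠ 0) {k j : ℕ} (h : vecR B (k + j) ∈ N) (hkj : k + j < n)
    (hr : r < k ∨ k + j ≤ r) : vecR B k ∈ N := by
  induction j with
  | zero => exact h
  | succ j ih =>
    refine ih ?_ (by omega) (by omega)
    have h1 := N.smul_mem (hE 𝕜 m n ξ) h
    rw [← add_assoc, hB.E_R_succ] at h1
    exact smul_mem_cancel
      (coef_shift_ne_zero hβ (isPrimitiveRoot_q hm hn hξ) hsr (by omega) (by omega)) h1

theorem vecL_mem_of_add (hβ : β ≠ 0) {k j : ℕ} (h : vecL B (k + j) ∈ N) (hkj : k + j < n)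
    (hs : s < k ∨ k + j ≤ s) (hR : ∀ i, k ≤ i → vecR B (r + 1 + i) ∈ N) : vecL B k ∈ N := by
  induction j with
  | zero => exact h
  | succ j ih =>
    refine ih ?_ (by omega) (by omega)
    have h1 := N.smul_mem (hE 𝕜 m n ξ) h
    rw [← add_assoc, hB.E_L_succ, N.add_mem_iff_left (hR _ (by omega))] at h1
    exact smul_mem_cancel
      (coef_resonant_ne_zero hβ (isPrimitiveRoot_q hm hn hξ) (by omega) (by omega) (by omega)) h1

theorem vecR_mem_of_lt (hβ : β ≠ 0) {k : ℕ} (hk : k < n) (h : vecR B k ∈ N) {j : ℕ} (hj : r < j) :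
    vecR B j ∈ N := by
  by_cases hjn : j < n
  · have h1 := hB.vecR_add_mem h (n - 1 - k)
    rw [show k + (n - 1 - k) = j + (n - 1 - j) by omega] at h1
    exact hB.vecR_mem_of_add hm hn hξ hsr hβ h1 (by omega) (by omega)
  · rw [vecR_of_le (by omega)]; exact N.zero_mem

theorem vecR_mem_of_le (hβ : β ≠ 0) {k : ℕ} (hk : k ≤ r) (h : vecR B k ∈ N) (j : ℕ) :
    vecR B j ∈ N := by
  have h1 : vecR B 0 ∈ N :=
    hB.vecR_mem_of_add hm hn hξ hsr hβ (by rwa [zero_add]) (by omega) (by omega)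
  simpa using hB.vecR_add_mem h1 j

theorem vecL_mem_of_lt (hβ : β ≠ 0) {k : ℕ} (hk : k < n) (h : vecL B k ∈ N) {j : ℕ} (hj : s < j) :
    vecL B j ∈ N := by
  by_cases hjn : j < n
  · have h1 := hB.vecL_add_mem h (n - 1 - k)
    rw [show k + (n - 1 - k) = j + (n - 1 - j) by omega] at h1
    refine hB.vecL_mem_of_add hm hn hξ hsr hβ h1 (by omega) (by omega) fun i hi => ?_
    rw [vecR_of_le (by omega)]; exact N.zero_mem
  · rw [vecL_of_le (by omega)]; exact N.zero_mem

theorem vecR_mem_of_vecL_mem (hβ : β ≠ 0) {k : ℕ} (hk : k < n) (h : vecL B k ∈ N) {j : ℕ}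
    (hj : r < j) : vecR B j ∈ N := by
  have h1 := N.smul_mem (hE 𝕜 m n ξ) (hB.vecL_mem_of_lt hm hn hξ hsr hβ hk h (Nat.lt_succ_self s))
  rw [hB.E_L_succ, coef_resonant (pow_ne_zero m (root_ne_zero hm hn hξ)), zero_smul, zero_add] at h1
  exact hB.vecR_mem_of_lt hm hn hξ hsr hβ (by omega) h1 hj

theorem eq_top_of_vecL_mem (hβ : β ≠ 0) {k : ℕ} (hk : k ≤ s) (h : vecL B k ∈ N) : N = ⊤ := by
  have h1 : vecL B 0 ∈ N := by
    refine hB.vecL_mem_of_add hm hn hξ hsr hβ (by rwa [zero_add]) (by omega) (by omega)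
      fun i _ => ?_
    exact hB.vecR_mem_of_vecL_mem hm hn hξ hsr hβ (by omega) h (by omega)
  have h2 := N.smul_mem (hE 𝕜 m n ξ) h1
  rw [hB.E_L_zero] at h2
  refine eq_top_iff.2 fun p _ => mem_of_vec_mem (B := B) (fun k _ => ?_) fun k _ =>
    hB.vecR_mem_of_le hm hn hξ hsr hβ le_rfl h2 k
  simpa using hB.vecL_add_mem h1 k

end Ladder

section Components

include hm hn hξ hsr

omit hn in
theorem weight_inj {i k : ℕ} (hi : i < n) (hk : k < n) (h : ξ⁻¹ ^ i * γ = ξ⁻¹ ^ k * γ)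
    (hγ : γ ≠ 0) : i = k := by
  have hle : n ≤ m * n := Nat.le_mul_of_pos_left n (by omega)
  exact hξ.inv.pow_inj (by omega) (by omega) (mul_right_cancel₀ hγ h)

theorem weight_cross {i k : ℕ} (hi : i < n) (hk : k < n)
    (h : ξ⁻¹ ^ i * (ξ ^ (r + 1) * γ) = ξ⁻¹ ^ k * γ) (hγ : γ ≠ 0) : i = r + 1 + k := by
  have h0 := root_ne_zero hm hn hξ
  have hle : 2 * n ≤ m * n := Nat.mul_le_mul_right n hm
  rw [← mul_assoc] at h
  have h1 := mul_right_cancel₀ hγ h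
  rw [inv_pow, inv_pow, inv_mul_eq_iff_eq_mul₀ (pow_ne_zero _ h0), eq_mul_inv_iff_mul_eq₀
    (pow_ne_zero _ h0), ← pow_add] at h1
  exact (hξ.pow_inj (by omega) (by omega) h1).symm

include hB

omit hsr in
open Classical in
theorem eigenProj_smul_vec (hγ : γ ^ (m * n) = 1) (μ : 𝕜) (hμ : μ ^ (m * n) = 1) (k : ℕ) :
    eigenProj (m * n) (hc : H 𝕜 m n ξ) μ • vecL B k
      = (if ξ⁻¹ ^ k * γ = μ then vecL B k else 0) ∧
    eigenProj (m * n) (hc : H 𝕜 m n ξ) μ • vecR B k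
      = (if ξ⁻¹ ^ k * (ξ ^ (r + 1) * γ) = μ then vecR B k else 0) := by
  have hN : ((m * n : ℕ) : 𝕜) ≠ 0 := by
    have : NeZero (m * n) := ⟨by positivity⟩
    exact hξ.neZero'.ne
  have hμ0 : μ ≠ 0 := by rintro rfl; rw [zero_pow (by positivity)] at hμ; exact zero_ne_one hμ
  have hξ1 : ∀ j : ℕ, (ξ⁻¹ ^ j) ^ (m * n) = 1 := fun j => by
    rw [pow_right_comm, inv_pow, hξ.pow_eq_one, inv_one, one_pow]
  have hξ2 : (ξ ^ (r + 1)) ^ (m * n) = 1 := by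
    rw [pow_right_comm, hξ.pow_eq_one, one_pow]
  constructor <;> split_ifs with h
  · exact eigenProj_smul_self hN hμ0 (h ▸ (hB.wt_L k).c)
  · exact eigenProj_smul_of_ne hμ (by rw [mul_pow, hξ1, hγ, one_mul]) h (hB.wt_L k).c
  · exact eigenProj_smul_self hN hμ0 (h ▸ (hB.wt_R k).c)
  · exact eigenProj_smul_of_ne hμ (by rw [mul_pow, mul_pow, hξ1, hξ2, hγ, one_mul, one_mul]) h
      (hB.wt_R k).c

variable {p : X} {k : ℕ}

theorem component_mem (hγ : γ ^ (m * n) = 1) (hp : p ∈ N) (hk : k < n) :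
    coL B k p • vecL B k + coR B (r + 1 + k) p • vecR B (r + 1 + k) ∈ N := by
  have hγ0 : γ ≠ 0 := by rintro rfl; rw [zero_pow (by positivity)] at hγ; exact zero_ne_one hγ
  have hμ : (ξ⁻¹ ^ k * γ) ^ (m * n) = 1 := by
    rw [mul_pow, pow_right_comm, inv_pow, hξ.pow_eq_one, hγ, inv_one, one_pow, one_mul]
  have key := hB.eigenProj_smul_vec hm hn hξ hγ _ hμ
  have : Algebra.lsmul 𝕜 𝕜 X (eigenProj (m * n) (hc : H 𝕜 m n ξ) (ξ⁻¹ ^ k * γ))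
      = (coL B k).smulRight (vecL B k) + (coR B (r + 1 + k)).smulRight (vecR B (r + 1 + k)) := by
    refine linearMap_ext_vec (B := B) (fun i => ?_) (fun i => ?_) <;>
      simp only [Algebra.lsmul_coe, key, LinearMap.add_apply, LinearMap.smulRight_apply, coL_vecL,
        coR_vecL, coL_vecR, coR_vecR, zero_smul, add_zero, zero_add]
    · by_cases hi : i < n
      · by_cases hik : k = i
        · simp [hik, hi]
        · rw [if_neg fun h => hik (weight_inj hm hξ hsr hi hk h hγ0).symm, if_neg (by tauto),
            zero_smul]
      · rw [vecL_of_le (by omega), ite_self, if_neg (by tauto), zero_smul]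
    · by_cases hi : i < n
      · by_cases hik : r + 1 + k = i
        · subst hik
          rw [if_pos, if_pos ⟨rfl, hi⟩, one_smul]
          rw [inv_pow, inv_pow, pow_add]
          have := root_ne_zero hm hn hξ
          field_simp
        · rw [if_neg fun h => hik (weight_cross hm hn hξ hsr hi hk h hγ0).symm, if_neg (by tauto),
            zero_smul]
      · rw [vecR_of_le (by omega), ite_self, if_neg (by tauto), zero_smul]
  rw [← LinearMap.smulRight_apply, ← LinearMap.smulRight_apply, ← LinearMap.add_apply, ← this]
  exact N.smul_mem _ hp

theorem component_mem_right (hγ : γ ^ (m * n) = 1) (hp : p ∈ N) (hk : k ≤ r) :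
    coR B k p • vecR B k ∈ N := by
  have hγ0 : γ ≠ 0 := by rintro rfl; rw [zero_pow (by positivity)] at hγ; exact zero_ne_one hγ
  have hγ' : (ξ ^ (r + 1) * γ) ^ (m * n) = 1 := by
    rw [mul_pow, pow_right_comm, hξ.pow_eq_one, hγ, one_pow, one_mul]
  have hμ : (ξ⁻¹ ^ k * (ξ ^ (r + 1) * γ)) ^ (m * n) = 1 := by
    rw [mul_pow, hγ', pow_right_comm, inv_pow, hξ.pow_eq_one, inv_one, one_pow, one_mul]
  have key := hB.eigenProj_smul_vec hm hn hξ hγ _ hμ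
  have : Algebra.lsmul 𝕜 𝕜 X (eigenProj (m * n) (hc : H 𝕜 m n ξ) (ξ⁻¹ ^ k * (ξ ^ (r + 1) * γ)))
      = (coR B k).smulRight (vecR B k) := by
    refine linearMap_ext_vec (B := B) (fun i => ?_) (fun i => ?_) <;>
      simp only [Algebra.lsmul_coe, key, LinearMap.smulRight_apply, coR_vecL, coR_vecR, zero_smul]
    · by_cases hi : i < n
      · refine if_neg fun h => ?_
        have := weight_cross hm hn hξ hsr (by omega) hi h.symm hγ0
        omega
      · rw [vecL_of_le (by omega), ite_self]
    · by_cases hi : i < n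
      · by_cases hik : k = i
        · simp [hik, hi]
        · rw [if_neg fun h => hik (weight_inj hm hξ hsr hi (by omega) h
            (mul_ne_zero (pow_ne_zero _ (root_ne_zero hm hn hξ)) hγ0)).symm, if_neg (by tauto),
            zero_smul]
      · rw [vecR_of_le (by omega), ite_self, if_neg (by tauto), zero_smul]
  rw [← LinearMap.smulRight_apply, ← this]
  exact N.smul_mem _ hp

variable (hβ : β ≠ 0) (hγ : γ ^ (m * n) = 1)
include hβ hγ

theorem vecR_mem_of_ne_bot (hN : N ≠ ⊥) {j : ℕ} (hj : r < j) : vecR B j ∈ N := by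
  obtain ⟨p, hp, hp0⟩ := N.ne_bot_iff.1 hN
  have hleft : ∀ k, coL B k p ≠ 0 → vecR B j ∈ N := fun k hk => by
    have hkn : k < n := by
      by_contra h
      exact hk (by rw [coL_of_le (by omega), LinearMap.zero_apply])
    have h1 := N.smul_mem (hd ^ (n - 1 - k)) (hB.component_mem hm hn hξ hsr hγ hp hkn)
    rw [smul_add, smul_comm, pow_smul_shift hB.F_L, smul_comm, pow_smul_shift hB.F_R,
      vecR_of_le (by omega), smul_zero, add_zero] at h1
    exact hB.vecR_mem_of_vecL_mem hm hn hξ hsr hβ (by omega) (smul_mem_cancel hk h1) hj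
  obtain ⟨k, hk⟩ | ⟨k, hk⟩ := exists_coord_ne_zero (B := B) hp0
  · exact hleft k hk
  · have hkn : k < n := by
      by_contra h
      exact hk (by rw [coR_of_le (by omega), LinearMap.zero_apply])
    by_cases hkr : k ≤ r
    · exact hB.vecR_mem_of_lt hm hn hξ hsr hβ hkn
        (smul_mem_cancel hk (hB.component_mem_right hm hn hξ hsr hγ hp hkr)) hj
    · by_cases hL : coL B (k - (r + 1)) p = 0
      · have h1 := hB.component_mem hm hn hξ hsr hγ hp (k := k - (r + 1)) (by omega)
        rw [hL, zero_smul, zero_add, show r + 1 + (k - (r + 1)) = k by omega] at h1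
        exact hB.vecR_mem_of_lt hm hn hξ hsr hβ hkn (smul_mem_cancel hk h1) hj
      · exact hleft _ hL

theorem vecR_mem_of_coR (hp : p ∈ N) (hk : coR B k p ≠ 0) : vecR B k ∈ N := by
  have hN : N ≠ ⊥ := by
    rintro rfl
    exact hk (by rw [(Submodule.mem_bot _).1 hp, map_zero])
  by_cases hkr : k ≤ r
  · exact smul_mem_cancel hk (hB.component_mem_right hm hn hξ hsr hγ hp hkr)
  · exact hB.vecR_mem_of_ne_bot hm hn hξ hsr hβ hγ hN (by omega)

theorem vecL_mem_of_coL (hp : p ∈ N) (hk : coL B k p ≠ 0) : vecL B k ∈ N := by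
  have hN : N ≠ ⊥ := by
    rintro rfl
    exact hk (by rw [(Submodule.mem_bot _).1 hp, map_zero])
  have hkn : k < n := by
    by_contra h
    exact hk (by rw [coL_of_le (by omega), LinearMap.zero_apply])
  have h1 := hB.component_mem hm hn hξ hsr hγ hp hkn
  rw [N.add_mem_iff_left (N.smul_of_tower_mem _
    (hB.vecR_mem_of_ne_bot hm hn hξ hsr hβ hγ hN (by omega)))] at h1
  exact smul_mem_cancel hk h1

end Components

variable (B) in
/-- The span of the left basis vectors from index `i` on and the right ones from index `j` on. -/
def vecSpan (i j : ℕ) : Submodule 𝕜 X :=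
  Submodule.span 𝕜 {x | (∃ k, i ≤ k ∧ x = vecL B k) ∨ ∃ k, j ≤ k ∧ x = vecR B k}

variable {i j : ℕ}

omit [Module (H 𝕜 m n ξ) X] [IsScalarTower 𝕜 (H 𝕜 m n ξ) X] in
theorem vecL_mem_vecSpan {k : ℕ} (h : i ≤ k) : vecL B k ∈ vecSpan B i j :=
  Submodule.subset_span (.inl ⟨k, h, rfl⟩)

omit [Module (H 𝕜 m n ξ) X] [IsScalarTower 𝕜 (H 𝕜 m n ξ) X] in
theorem vecR_mem_vecSpan {k : ℕ} (h : j ≤ k) : vecR B k ∈ vecSpan B i j :=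
  Submodule.subset_span (.inr ⟨k, h, rfl⟩)

omit [Module (H 𝕜 m n ξ) X] [IsScalarTower 𝕜 (H 𝕜 m n ξ) X] in
theorem coord_eq_zero_of_mem_vecSpan {p : X} (hp : p ∈ vecSpan B i j) :
    (∀ k < i, coL B k p = 0) ∧ ∀ k < j, coR B k p = 0 := by
  induction hp using Submodule.span_induction with
  | mem x hx =>
    obtain ⟨l, hl, rfl⟩ | ⟨l, hl, rfl⟩ := hx
    · exact ⟨fun k hk => by rw [coL_vecL, if_neg (by omega)], fun k _ => coR_vecL k l⟩
    · exact ⟨fun k _ => coL_vecR k l, fun k hk => by rw [coR_vecR, if_neg (by omega)]⟩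
  | zero => simp
  | add x y _ _ hx hy =>
    exact ⟨fun k hk => by rw [map_add, hx.1 k hk, hy.1 k hk, add_zero],
      fun k hk => by rw [map_add, hx.2 k hk, hy.2 k hk, add_zero]⟩
  | smul t x _ hx =>
    exact ⟨fun k hk => by rw [map_smul, hx.1 k hk, smul_zero],
      fun k hk => by rw [map_smul, hx.2 k hk, smul_zero]⟩

theorem smul_mem_vecSpan {a : H 𝕜 m n ξ} (hL : ∀ k, i ≤ k → a • vecL B k ∈ vecSpan B i j)
    (hR : ∀ k, j ≤ k → a • vecR B k ∈ vecSpan B i j) (x : X) (hx : x ∈ vecSpan B i j) :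
    a • x ∈ vecSpan B i j := by
  induction hx using Submodule.span_induction with
  | mem x hx =>
    obtain ⟨l, hl, rfl⟩ | ⟨l, hl, rfl⟩ := hx
    · exact hL l hl
    · exact hR l hl
  | zero => rw [smul_zero]; exact zero_mem _
  | add x y _ _ hx hy => rw [smul_add]; exact add_mem hx hy
  | smul t x _ hx => rw [smul_comm]; exact Submodule.smul_mem _ _ hx

include hm hn hξ hsr in
theorem E_smul_mem_vecSpan (hB : IsModel m ξ s r β γ B) (hi : i = s + 1 ∨ i = n)
    (hj : j = 0 ∨ j = r + 1) (x : X) (hx : x ∈ vecSpan B i j) :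
    hE 𝕜 m n ξ • x ∈ vecSpan B i j := by
  have hq := isPrimitiveRoot_q hm hn hξ
  have hq0 := pow_ne_zero m (root_ne_zero hm hn hξ)
  have hqn : (ξ ^ m) ^ (n - 1 + 1) = 1 := by rw [Nat.sub_add_cancel hn.le, hq.pow_eq_one]
  refine smul_mem_vecSpan (fun k hk => ?_) (fun k hk => ?_) x hx
  · obtain _ | k := k
    · omega
    · rw [hB.E_L_succ]
      refine add_mem ?_ (vecR_mem_vecSpan (by omega))
      by_cases h : i ≤ k
      · exact Submodule.smul_mem _ _ (vecL_mem_vecSpan h)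
      · have h0 : coef (ξ ^ m) β ((ξ ^ m) ^ s * β) k = 0 := by
          obtain rfl | rfl : k = s ∨ k = n - 1 := by omega
          · exact coef_resonant hq0
          · exact coef_eq_zero_of_pow_eq_one hqn
        rw [h0, zero_smul]
        exact zero_mem _
  · obtain _ | k := k
    · rw [hB.E_R_zero]; exact zero_mem _
    · rw [hB.E_R_succ]
      by_cases h : j ≤ k
      · exact Submodule.smul_mem _ _ (vecR_mem_vecSpan h)
      · obtain rfl : k = r := by omega
        rw [coef_shift hq0, show s + 1 + k = n - 1 by omega, coef_eq_zero_of_pow_eq_one hqn,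
          zero_smul]
        exact zero_mem _

/-- The submodules of the standard module spanned by basis vectors. -/
def filt (hB : IsModel m ξ s r β γ B) (hi : i = s + 1 ∨ i = n) (hj : j = 0 ∨ j = r + 1) :
    Submodule (H 𝕜 m n ξ) X :=
  stableSubmodule (vecSpan B i j) (E_smul_mem_vecSpan hm hn hξ hsr hB hi hj)
    (smul_mem_vecSpan
      (fun k hk => by rw [(hB.wt_L k).b]; exact Submodule.smul_mem _ _ (vecL_mem_vecSpan hk))
      (fun k hk => by rw [(hB.wt_R k).b]; exact Submodule.smul_mem _ _ (vecR_mem_vecSpan hk)))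
    (smul_mem_vecSpan
      (fun k hk => by rw [(hB.wt_L k).c]; exact Submodule.smul_mem _ _ (vecL_mem_vecSpan hk))
      (fun k hk => by rw [(hB.wt_R k).c]; exact Submodule.smul_mem _ _ (vecR_mem_vecSpan hk)))
    (smul_mem_vecSpan
      (fun k hk => by rw [hB.F_L]; exact vecL_mem_vecSpan (by omega))
      (fun k hk => by rw [hB.F_R]; exact vecR_mem_vecSpan (by omega)))

section Filtration

variable {hm hn hξ hsr} {hB : IsModel m ξ s r β γ B} {hi : i = s + 1 ∨ i = n}
  {hj : j = 0 ∨ j = r + 1}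

theorem filt_le (hL : ∀ k, i ≤ k → vecL B k ∈ N) (hR : ∀ k, j ≤ k → vecR B k ∈ N) :
    filt hm hn hξ hsr hB hi hj ≤ N := by
  intro p hp
  obtain ⟨h1, h2⟩ := coord_eq_zero_of_mem_vecSpan hp
  exact mem_of_vec_mem (B := B) (fun k hk => hL k (not_lt.1 fun h => hk (h1 k h)))
    fun k hk => hR k (not_lt.1 fun h => hk (h2 k h))

theorem vecL_mem_filt {k : ℕ} (h : i ≤ k) : vecL B k ∈ filt hm hn hξ hsr hB hi hj :=
  vecL_mem_vecSpan h

theorem vecR_mem_filt {k : ℕ} (h : j ≤ k) : vecR B k ∈ filt hm hn hξ hsr hB hi hj :=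
  vecR_mem_vecSpan h

theorem exists_coord_of_notMem_filt {p : X} (hp : p ∉ filt hm hn hξ hsr hB hi hj) :
    (∃ k < i, coL B k p ≠ 0) ∨ ∃ k < j, coR B k p ≠ 0 := by
  by_contra! h
  exact hp (mem_of_vec_mem (B := B)
    (fun k hk => vecL_mem_filt (not_lt.1 fun h' => hk (h.1 k h')))
    (fun k hk => vecR_mem_filt (not_lt.1 fun h' => hk (h.2 k h'))))

end Filtration

theorem isDiamond (hB : IsModel m ξ s r β γ B) (hβ : β ≠ 0) (hγ : γ ^ (m * n) = 1) :
    IsDiamond (filt hm hn hξ hsr hB (.inl rfl) (.inl rfl))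
      (filt hm hn hξ hsr hB (.inr rfl) (.inr rfl)) (filt hm hn hξ hsr hB (.inr rfl) (.inl rfl))
      (filt hm hn hξ hsr hB (.inl rfl) (.inr rfl)) := by
  have hzL : ∀ {k : ℕ} {N : Submodule (H 𝕜 m n ξ) X}, n ≤ k → vecL B k ∈ N := fun hk => by
    rw [vecL_of_le hk]; exact zero_mem _
  refine ⟨fun N hN => ?_, fun N hN => ?_, ⟨lt_of_le_of_ne ?_ ?_, fun N h1 h2 => ?_⟩,
    ⟨lt_of_le_of_ne ?_ ?_, fun N h1 h2 => ?_⟩, le_antisymm (sup_le ?_ ?_) ?_, ?_, ?_⟩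
  · by_contra h
    obtain ⟨p, hp, hp'⟩ := SetLike.not_le_iff_exists.1 h
    obtain ⟨k, hk, hkp⟩ | ⟨k, hk, -⟩ := exists_coord_of_notMem_filt hp'
    · exact hN (hB.eq_top_of_vecL_mem hm hn hξ hsr hβ (by omega)
        (hB.vecL_mem_of_coL hm hn hξ hsr hβ hγ hp hkp))
    · omega
  · exact filt_le (fun k hk => hzL hk) fun k hk =>
      hB.vecR_mem_of_ne_bot hm hn hξ hsr hβ hγ hN hk
  · exact filt_le (fun k hk => hzL hk) fun k _ => vecR_mem_filt (by omega)
  · intro h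
    have h1 : vecR B 0 ∈ filt hm hn hξ hsr hB (.inr rfl) (.inr rfl) := h ▸ vecR_mem_filt le_rfl
    have := (coord_eq_zero_of_mem_vecSpan h1).2 0 (by omega)
    rw [coR_vecR, if_pos ⟨rfl, by omega⟩] at this
    exact one_ne_zero this
  · obtain ⟨p, hp, hp'⟩ := SetLike.not_le_iff_exists.1 h1.not_ge
    have h3 := (coord_eq_zero_of_mem_vecSpan (h2.le hp)).1
    obtain ⟨k, hk, hkp⟩ | ⟨k, hk, hkp⟩ := exists_coord_of_notMem_filt hp'
    · exact hkp (h3 k hk)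
    · exact h2.not_ge (filt_le (fun k hk => hzL hk) fun j _ =>
        hB.vecR_mem_of_le hm hn hξ hsr hβ (by omega)
          (hB.vecR_mem_of_coR hm hn hξ hsr hβ hγ hp hkp) j)
  · exact filt_le (fun k hk => hzL hk) fun k hk => vecR_mem_filt hk
  · intro h
    have h1 : vecL B (s + 1) ∈ filt hm hn hξ hsr hB (.inr rfl) (.inr rfl) :=
      h ▸ vecL_mem_filt le_rfl
    have := (coord_eq_zero_of_mem_vecSpan h1).1 (s + 1) (by omega)
    rw [coL_vecL, if_pos ⟨rfl, by omega⟩] at this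
    exact one_ne_zero this
  · obtain ⟨p, hp, hp'⟩ := SetLike.not_le_iff_exists.1 h1.not_ge
    have h3 := (coord_eq_zero_of_mem_vecSpan (h2.le hp)).2
    obtain ⟨k, hk, hkp⟩ | ⟨k, hk, hkp⟩ := exists_coord_of_notMem_filt hp'
    · exact h2.not_ge (filt_le (fun j hj => hB.vecL_mem_of_lt hm hn hξ hsr hβ hk
        (hB.vecL_mem_of_coL hm hn hξ hsr hβ hγ hp hkp) hj) fun j hj => h1.le (vecR_mem_filt hj))
    · exact hkp (h3 k hk)
  · exact filt_le (fun k hk => hzL hk) fun k hk => vecR_mem_filt hk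
  · exact filt_le (fun k hk => vecL_mem_filt hk) fun k _ => vecR_mem_filt (by omega)
  · exact filt_le
      (fun k hk => (le_sup_right : _ ≤ filt hm hn hξ hsr hB (.inr rfl) (.inl rfl) ⊔ _)
        (vecL_mem_filt hk))
      fun k hk => (le_sup_left : filt hm hn hξ hsr hB (.inr rfl) (.inl rfl) ≤ _) (vecR_mem_filt hk)
  · intro h
    have h1 : vecL B 0 ∈ filt hm hn hξ hsr hB (.inl rfl) (.inl rfl) := h ▸ Submodule.mem_top
    have := (coord_eq_zero_of_mem_vecSpan h1).1 0 (by omega)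
    rw [coL_vecL, if_pos ⟨rfl, by omega⟩] at this
    exact one_ne_zero this
  · intro h
    have h1 : vecR B (r + 1) ∈ (⊥ : Submodule (H 𝕜 m n ξ) X) := h ▸ vecR_mem_filt le_rfl
    have h2 := congrArg (coR B (r + 1)) ((Submodule.mem_bot _).1 h1)
    rw [coR_vecR, if_pos ⟨rfl, by omega⟩, map_zero] at h2
    exact one_ne_zero h2

end IsModel

end Diamond

section TopCover

variable {R Y Q T : Type*} [Ring R] [AddCommGroup Y] [Module R Y] [AddCommGroup Q] [Module R Q]
  [AddCommGroup T] [Module R T]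

/-- If `Q` has a largest proper submodule, a map to `Q` whose composite with some map to a simple
module is nonzero is surjective. -/
theorem surjective_of_comp_ne_zero [IsSimpleModule R T] {N₁ : Submodule R Q} (htop : N₁ ≠ ⊤)
    (hN : ∀ N : Submodule R Q, N ≠ ⊤ → N ≤ N₁) {h : Q →ₗ[R] T} {φ : Y →ₗ[R] Q}
    (hφ : h ∘ₗ φ ≠ 0) : Function.Surjective φ := by
  rw [← LinearMap.range_eq_top]
  by_contra hr
  have hk : LinearMap.ker h ≠ ⊤ := fun hk =>
    hφ (by rw [LinearMap.ker_eq_top.1 hk, LinearMap.zero_comp])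
  refine htop (top_le_iff.1 fun q _ => ?_)
  obtain ⟨y, hy⟩ := (LinearMap.surjective_of_ne_zero hφ) (h q)
  rw [← sub_add_cancel q (φ y)]
  refine N₁.add_mem (hN _ hk ?_) (hN _ hr ⟨y, rfl⟩)
  rw [LinearMap.mem_ker, map_sub, sub_eq_zero, ← hy, LinearMap.comp_apply]

theorem isCompl_ker_range_of_bijective {f : Y →ₗ[R] Q} {g : Q →ₗ[R] Y}
    (hfg : Function.Bijective (f ∘ₗ g)) : IsCompl (LinearMap.ker f) (LinearMap.range g) := by
  refine ⟨Submodule.disjoint_def.2 ?_, codisjoint_iff.2 (eq_top_iff.2 fun y _ => ?_)⟩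
  · rintro _ hy ⟨q, rfl⟩
    rw [hfg.1 (a₁ := q) (a₂ := 0) (by simpa using hy), map_zero]
  · obtain ⟨q, hq⟩ := hfg.2 (f y)
    rw [← sub_add_cancel y (g q)]
    refine Submodule.add_mem_sup ?_ ⟨q, rfl⟩
    rw [LinearMap.mem_ker, map_sub, sub_eq_zero, ← hq, LinearMap.comp_apply]

end TopCover

section HighestWeight

variable {𝕜 m n ξ} {M : Type*} [AddCommGroup M] [Module 𝕜 M] [Module (H 𝕜 m n ξ) M]
  [IsScalarTower 𝕜 (H 𝕜 m n ξ) M]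

theorem exists_eigenvector_mem [IsAlgClosed 𝕜] {V : Type*} [AddCommGroup V] [Module 𝕜 V]
    [FiniteDimensional 𝕜 V] {f : Module.End 𝕜 V} {S : Submodule 𝕜 V} (hS : S ≠ ⊥)
    (hf : ∀ x ∈ S, f x ∈ S) : ∃ μ : 𝕜, ∃ x ∈ S, x ≠ 0 ∧ f x = μ • x := by
  have : Nontrivial S := Submodule.nontrivial_iff_ne_bot.2 hS
  obtain ⟨μ, hμ⟩ := Module.End.exists_eigenvalue (f.restrict hf)
  obtain ⟨x, hx⟩ := hμ.exists_hasEigenvector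
  exact ⟨μ, x, x.2, fun h => hx.2 (Subtype.ext h), congrArg Subtype.val hx.apply_eq_smul⟩

variable (hm : 1 < m) (hn : 1 < n) (hξ : IsPrimitiveRoot ξ (m * n))
include hm hn hξ

variable (M) in
theorem exists_highestWeight [IsAlgClosed 𝕜] [FiniteDimensional 𝕜 M] [Nontrivial M] :
    ∃ (β γ : 𝕜) (z : M), z ≠ 0 ∧ IsWt m n ξ β γ z ∧ hE 𝕜 m n ξ • z = 0 := by
  have hR := shiftedRel_gen (𝕜 := 𝕜) hm hn hξ
  let op : H 𝕜 m n ξ → Module.End 𝕜 M := Algebra.lsmul 𝕜 𝕜 M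
  have hker : LinearMap.ker (op (hE 𝕜 m n ξ)) ≠ ⊥ := by
    intro h
    rw [LinearMap.ker_eq_bot] at h
    obtain ⟨x, hx⟩ := exists_ne (0 : M)
    refine hx (h.iterate n (a₁ := x) (a₂ := 0) ?_)
    rw [← Module.End.pow_apply, ← Module.End.pow_apply, map_zero]
    simp only [op, ← map_pow, hE_pow hm hn hξ, map_zero, LinearMap.zero_apply]
  obtain ⟨β, x, hx, hx0, hxb⟩ := exists_eigenvector_mem (f := op hb) hker fun x hx => by
    simp only [op, LinearMap.mem_ker, Algebra.lsmul_coe] at hx ⊢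
    rw [← mul_smul, hR.Eb, smul_assoc, mul_smul, hx, smul_zero, smul_zero]
  have hS : LinearMap.ker (op (hE 𝕜 m n ξ)) ⊓ LinearMap.ker (op hb - β • 1) ≠ ⊥ :=
    (Submodule.ne_bot_iff _).2 ⟨x, ⟨hx, by simp [hxb]⟩, hx0⟩
  obtain ⟨γ, z, ⟨hzE, hzb⟩, hz0, hzc⟩ := exists_eigenvector_mem (f := op hc) hS fun x hx => by
    simp only [op, Submodule.mem_inf, LinearMap.mem_ker, Algebra.lsmul_coe, LinearMap.sub_apply,
      LinearMap.smul_apply, Module.End.one_apply] at hx ⊢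
    obtain ⟨hx1, hx2⟩ := hx
    constructor
    · rw [← mul_smul, hR.Ec, smul_assoc, mul_smul, hx1, smul_zero, smul_zero]
    · rw [← mul_smul, hR.bc, mul_smul, smul_comm β, ← smul_sub, hx2, smul_zero]
  refine ⟨β, γ, z, hz0, ⟨?_, hzc⟩, hzE⟩
  simpa [op, sub_eq_zero] using hzb

theorem exists_wt_lift {T : Type*} [AddCommGroup T] [Module 𝕜 T] [Module (H 𝕜 m n ξ) T]
    [IsScalarTower 𝕜 (H 𝕜 m n ξ) T] {π : M →ₗ[H 𝕜 m n ξ] T} (hπ : Function.Surjective π)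
    {β γ : 𝕜} {z : T} (hz : z ≠ 0) (h : IsWt m n ξ β γ z) :
    ∃ x : M, IsWt m n ξ β γ x ∧ π x = z := by
  have hN : m * n ≠ 0 := by positivity
  have hN' : ((m * n : ℕ) : 𝕜) ≠ 0 := by
    have : NeZero (m * n) := ⟨hN⟩
    exact hξ.neZero'.ne
  have hβ := h.b_root hz
  have hγ := h.c_root hz
  have ne0 : ∀ {μ : 𝕜}, μ ^ (m * n) = 1 → μ ≠ 0 := by
    rintro _ h rfl
    rw [zero_pow hN] at h
    exact zero_ne_one h
  obtain ⟨p, rfl⟩ := hπ z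
  have hcomm : Commute (hc : H 𝕜 m n ξ) (eigenProj (m * n) hb β) := by
    refine Commute.smul_right (Commute.sum_right _ _ _ fun j _ => Commute.smul_right ?_ _) _
    exact Commute.pow_right (shiftedRel_gen hm hn hξ).bc.symm j
  refine ⟨eigenProj (m * n) (hb : H 𝕜 m n ξ) β • eigenProj (m * n) (hc : H 𝕜 m n ξ) γ • p,
    ⟨?_, ?_⟩, ?_⟩
  · rw [← mul_smul, mul_eigenProj hN hβ gen_b_pow, smul_assoc]
  · rw [← mul_smul, hcomm.eq, mul_smul, ← mul_smul hc, mul_eigenProj hN hγ gen_c_pow, smul_assoc,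
      smul_comm]
  · rw [map_smul, map_smul, eigenProj_smul_self hN' (ne0 hγ) h.c,
      eigenProj_smul_self hN' (ne0 hβ) h.b]

/-- A linear map out of the standard projective is determined by a highest weight vector `u` and
a vector `x` with `E x = Fʳ u`. -/
theorem IsModel.exists_hom {X : Type*} [AddCommGroup X] [Module 𝕜 X] [Module (H 𝕜 m n ξ) X]
    [IsScalarTower 𝕜 (H 𝕜 m n ξ) X] {s r : ℕ} {β γ : 𝕜} {B : Module.Basis (Fin n ⊕ Fin n) 𝕜 X}
    (hB : IsModel m ξ s r β γ B) (hsr : n = s + r + 2) (hβγ : γ ^ m = (ξ ^ m) ^ s * β) {x u : M}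
    (hx : IsWt m n ξ β γ x) (hu : IsWt m n ξ ((ξ ^ m) ^ (s + 1) * β) (ξ ^ (r + 1) * γ) u)
    (hEx : hE 𝕜 m n ξ • x = (hd : H 𝕜 m n ξ) ^ r • u) (hEu : hE 𝕜 m n ξ • u = 0) :
    ∃ g : X →ₗ[H 𝕜 m n ξ] M, g (vecL B 0) = x := by
  have hq := isPrimitiveRoot_q hm hn hξ
  have hq0 := pow_ne_zero m (root_ne_zero hm hn hξ)
  have hF : ∀ (p : M) (k : ℕ), n ≤ k → (hd : H 𝕜 m n ξ) ^ k • p = 0 := fun p k hk => by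
    rw [pow_eq_zero_of_le hk (shiftedRel_gen hm hn hξ).FPow, zero_smul]
  let g : X →ₗ[𝕜] M := vecMap B (fun k => (hd : H 𝕜 m n ξ) ^ k • x)
    (fun k => (hd : H 𝕜 m n ξ) ^ k • u)
  have gL : ∀ k, g (vecL B k) = (hd : H 𝕜 m n ξ) ^ k • x := vecMap_vecL (hF x)
  have gR : ∀ k, g (vecR B k) = (hd : H 𝕜 m n ξ) ^ k • u := vecMap_vecR (hF u)
  have hγu : (ξ ^ (r + 1) * γ) ^ m = (ξ ^ m)⁻¹ * β := by
    rw [mul_pow, hβγ, eq_inv_mul_iff_mul_eq₀ hq0, pow_right_comm, ← mul_assoc, ← mul_assoc,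
      ← pow_succ', ← pow_add, show r + 1 + 1 + s = n by omega, hq.pow_eq_one, one_mul]
  have equiv : ∀ a : H 𝕜 m n ξ, (∀ k, g (a • vecL B k) = a • (hd : H 𝕜 m n ξ) ^ k • x) →
      (∀ k, g (a • vecR B k) = a • (hd : H 𝕜 m n ξ) ^ k • u) → ∀ p, g (a • p) = a • g p := by
    intro a h1 h2 p
    have : g ∘ₗ Algebra.lsmul 𝕜 𝕜 X a = Algebra.lsmul 𝕜 𝕜 M a ∘ₗ g :=
      linearMap_ext_vec (B := B) (fun k => by simp [h1, gL]) (fun k => by simp [h2, gR])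
    exact LinearMap.congr_fun this p
  refine ⟨equivariantMap g (equiv _ ?_ ?_) (equiv _ ?_ ?_) (equiv _ ?_ ?_) (equiv _ ?_ ?_), ?_⟩
  · rintro (_ | k)
    · rw [hB.E_L_zero, gR, pow_zero, one_smul, hEx]
    · rw [hB.E_L_succ, map_add, map_smul, gL, gR, hx.E_pow_F hm hn hξ, hEx, hβγ, ← mul_smul,
        ← pow_add, add_comm, show r + 1 + k = k + 1 + r by ring]
  · rintro (_ | k)
    · rw [hB.E_R_zero, map_zero, pow_zero, one_smul, hEu]
    · rw [hB.E_R_succ, map_smul, gR, hu.E_pow_F hm hn hξ, hEu, hγu, smul_zero, zero_add]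
  · intro k
    rw [(hB.wt_L k).b, map_smul, gL, (hx.pow_F hm hn hξ k).b]
  · intro k
    rw [(hB.wt_R k).b, map_smul, gR, (hu.pow_F hm hn hξ k).b, ← mul_assoc, ← pow_add,
      add_comm (s + 1)]
  · intro k
    rw [(hB.wt_L k).c, map_smul, gL, (hx.pow_F hm hn hξ k).c]
  · intro k
    rw [(hB.wt_R k).c, map_smul, gR, (hu.pow_F hm hn hξ k).c]
  · intro k
    rw [hB.F_L, gL, pow_succ', mul_smul]
  · intro k
    rw [hB.F_R, gR, pow_succ', mul_smul]
  · rw [equivariantMap_apply, gL, pow_zero, one_smul]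

variable {β γ : 𝕜}

theorem coef_ne_zero_of_isSimpleModule [IsSimpleModule (H 𝕜 m n ξ) M] {z : M}
    (hz : IsWt m n ξ β γ z) (hEz : hE 𝕜 m n ξ • z = 0) {s : ℕ}
    (hs : (hd : H 𝕜 m n ξ) ^ s • z ≠ 0) (hs1 : (hd : H 𝕜 m n ξ) ^ (s + 1) • z = 0) {k : ℕ}
    (hk : k < s) : coef (ξ ^ m) β (γ ^ m) k ≠ 0 := by
  intro h0
  let S : Submodule 𝕜 M := Submodule.span 𝕜 {x | ∃ i, k + 1 ≤ i ∧ x = (hd : H 𝕜 m n ξ) ^ i • z}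
  have hmem : ∀ i, k + 1 ≤ i → (hd : H 𝕜 m n ξ) ^ i • z ∈ S := fun i hi =>
    Submodule.subset_span ⟨i, hi, rfl⟩
  have stable : ∀ a : H 𝕜 m n ξ, (∀ i, k + 1 ≤ i → a • (hd : H 𝕜 m n ξ) ^ i • z ∈ S) →
      ∀ x ∈ S, a • x ∈ S := by
    intro a ha' x hx
    refine (Submodule.span_le (p := S.comap (Algebra.lsmul 𝕜 𝕜 M a))).2 ?_ hx
    rintro _ ⟨i, hi, rfl⟩
    exact ha' i hi
  let N : Submodule (H 𝕜 m n ξ) M := stableSubmodule S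
    (stable _ fun i hi => by
      obtain ⟨i, rfl⟩ := Nat.exists_eq_add_of_le hi
      rw [show k + 1 + i = k + i + 1 by ring, hz.E_pow_F hm hn hξ, hEz, smul_zero, zero_add]
      obtain _ | i := i
      · rw [add_zero, h0, zero_smul]; exact S.zero_mem
      · exact S.smul_mem _ (hmem _ (by omega)))
    (stable _ fun i hi => by
      rw [(hz.pow_F hm hn hξ i).b]; exact S.smul_mem _ (hmem _ hi))
    (stable _ fun i hi => by
      rw [(hz.pow_F hm hn hξ i).c]; exact S.smul_mem _ (hmem _ hi))
    (stable _ fun i hi => by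
      rw [← mul_smul, ← pow_succ']; exact hmem _ (by omega))
  have hN : N = ⊤ := (eq_bot_or_eq_top N).resolve_left
    (N.ne_bot_iff.2 ⟨_, hmem s (by omega), hs⟩)
  have hzS : z ∈ S := by
    have : z ∈ N := hN ▸ Submodule.mem_top
    exact this
  refine hs ((Submodule.span_le (p := LinearMap.ker
    (Algebra.lsmul 𝕜 𝕜 M ((hd : H 𝕜 m n ξ) ^ s)))).2 ?_ hzS)
  rintro _ ⟨i, hi, rfl⟩
  obtain ⟨i, rfl⟩ := Nat.exists_eq_add_of_le hi
  change (hd : H 𝕜 m n ξ) ^ s • (hd : H 𝕜 m n ξ) ^ (k + 1 + i) • z = 0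
  rw [← mul_smul, ← pow_add, show s + (k + 1 + i) = k + i + (s + 1) by ring, pow_add,
    mul_smul, hs1, smul_zero]

theorem exists_pow_E_pow_F [IsSimpleModule (H 𝕜 m n ξ) M] {z : M}
    (hz : IsWt m n ξ β γ z) (hEz : hE 𝕜 m n ξ • z = 0) {s : ℕ}
    (hs : (hd : H 𝕜 m n ξ) ^ s • z ≠ 0) (hs1 : (hd : H 𝕜 m n ξ) ^ (s + 1) • z = 0) :
    ∃ κ : 𝕜, κ ≠ 0 ∧ hE 𝕜 m n ξ ^ s • (hd : H 𝕜 m n ξ) ^ s • z = κ • z := by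
  refine ⟨∏ k ∈ Finset.range s, coef (ξ ^ m) β (γ ^ m) k, Finset.prod_ne_zero_iff.2 fun k hk =>
    coef_ne_zero_of_isSimpleModule hm hn hξ hz hEz hs hs1 (Finset.mem_range.1 hk), ?_⟩
  have := pow_smul_chain (a := hE 𝕜 m n ξ) (u := fun k => (hd : H 𝕜 m n ξ) ^ k • z)
    (t := coef (ξ ^ m) β (γ ^ m))
    (fun k => by rw [hz.E_pow_F hm hn hξ, hEz, smul_zero, zero_add]) 0 s
  simpa using this

end HighestWeight

section Casimir

variable {𝕜 m n ξ}

variable (𝕜 m n ξ) in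
/-- The shifted Casimir element `F E + (b + q cᵐ - χ) / (1 - q)`. -/
def casimir (χ : 𝕜) : H 𝕜 m n ξ :=
  hd * hE 𝕜 m n ξ + (1 - ξ ^ m)⁻¹ • (hb + ξ ^ m • hc ^ m - algebraMap 𝕜 (H 𝕜 m n ξ) χ)

variable (hm : 1 < m) (hn : 1 < n) (hξ : IsPrimitiveRoot ξ (m * n))
include hm hn hξ

theorem casimir_mem_center (χ : 𝕜) : casimir 𝕜 m n ξ χ ∈ Subalgebra.center 𝕜 (H 𝕜 m n ξ) := by
  have hR := shiftedRel_gen (𝕜 := 𝕜) hm hn hξ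
  have h0 := root_ne_zero hm hn hξ
  have hq0 := pow_ne_zero m h0
  have hq1 : 1 - ξ ^ m ≠ 0 := sub_ne_zero.2 (q_ne_one hm hn hξ).symm
  have hEg := qcomm_pow_right hR.Ec m
  rw [inv_pow] at hEg
  have hFg := qcomm_pow_right hR.Fc m
  have hFb := qcomm_symm hq0 hR.bF
  have hgb : hb * hc ^ m = hc ^ m * (hb : H 𝕜 m n ξ) :=
    (show Commute (hb : H 𝕜 m n ξ) hc from hR.bc).pow_right m
  rw [Subalgebra.mem_center_iff]
  refine shifted_induction (fun s => Algebra.commutes s _) ?_ ?_ ?_ ?_ (fun x y hx hy => ?_)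
    (fun x y hx hy => ?_)
  · have h1 : hE 𝕜 m n ξ * (hd * hE 𝕜 m n ξ) = hd * hE 𝕜 m n ξ * hE 𝕜 m n ξ
        + (hb - hc ^ m) * hE 𝕜 m n ξ := by rw [← mul_assoc, hR.EF, add_mul]
    rw [casimir, mul_add, h1, mul_smul_comm, mul_sub, mul_add, mul_smul_comm, hR.Eb, hEg,
      ← Algebra.commutes, add_mul, smul_mul_assoc, sub_mul _ (algebraMap _ _ _), add_mul, sub_mul,
      smul_mul_assoc]
    match_scalars <;> field_simp <;> ring
  · have h1 : hb * (hd * hE 𝕜 m n ξ) = hd * hE 𝕜 m n ξ * hb := by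
      rw [← mul_assoc, hR.bF, mul_assoc, hR.Eb, mul_smul_comm, smul_mul_assoc, mul_assoc]
    rw [casimir, mul_add, h1, mul_smul_comm, mul_sub, mul_add, mul_smul_comm, hgb,
      ← Algebra.commutes, add_mul, smul_mul_assoc, sub_mul _ (algebraMap _ _ _), add_mul,
      smul_mul_assoc]
  · have h1 : hc * (hd * hE 𝕜 m n ξ) = hd * hE 𝕜 m n ξ * hc := by
      rw [mul_assoc, hR.Ec, mul_smul_comm, ← mul_assoc, ← mul_assoc, hR.Fc, smul_mul_assoc,
        inv_smul_smul₀ h0]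
    rw [casimir, mul_add, h1, mul_smul_comm, mul_sub, mul_add, mul_smul_comm, ← hR.bc,
      (Commute.self_pow (hc : H 𝕜 m n ξ) m).eq,
      ← Algebra.commutes, add_mul, smul_mul_assoc, sub_mul _ (algebraMap _ _ _), add_mul,
      smul_mul_assoc]
  · have h1 : hd * (hd * hE 𝕜 m n ξ) = hd * hE 𝕜 m n ξ * hd
        - (ξ ^ m)⁻¹ • (hb * hd) + ξ ^ m • (hc ^ m * (hd : H 𝕜 m n ξ)) := by
      rw [mul_assoc, hR.EF, mul_add, mul_sub, hFb, hFg]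
      abel
    rw [casimir, mul_add, h1, mul_smul_comm, mul_sub, mul_add, mul_smul_comm, hFb, hFg,
      ← Algebra.commutes, add_mul, smul_mul_assoc, sub_mul _ (algebraMap _ _ _), add_mul,
      smul_mul_assoc]
    match_scalars <;> field_simp <;> ring
  · rw [add_mul, mul_add, hx, hy]
  · rw [mul_assoc, hy, ← mul_assoc, hx, mul_assoc]

variable {M : Type*} [AddCommGroup M] [Module 𝕜 M] [Module (H 𝕜 m n ξ) M]
  [IsScalarTower 𝕜 (H 𝕜 m n ξ) M] {β γ χ : 𝕜}

omit hm hn hξ in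
theorem IsWt.casimir_smul {p : M} (hp : IsWt m n ξ β γ p) : casimir 𝕜 m n ξ χ • p
    = (hd : H 𝕜 m n ξ) • hE 𝕜 m n ξ • p
      + ((1 - ξ ^ m)⁻¹ * (β + ξ ^ m * γ ^ m - χ)) • p := by
  simp only [casimir, add_smul, sub_smul, smul_assoc, hp.b, hp.c_pow, algebraMap_smul, mul_smul]

/-- On a weight vector, `F^k E^k` acts through a central element, which is nonzero on highest
weight vectors with the given Casimir value as long as the weights do not resonate. -/
theorem exists_central_pow_F_pow_E {T : Type*} [AddCommGroup T] [Module 𝕜 T]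
    [Module (H 𝕜 m n ξ) T] [IsScalarTower 𝕜 (H 𝕜 m n ξ) T] {s r : ℕ} (hsr : n = s + r + 2)
    (hβ : β ≠ 0) (hβγ : γ ^ m = (ξ ^ m) ^ s * β) {p : M} {z : T} (hp : IsWt m n ξ β γ p)
    (hz : IsWt m n ξ β γ z) (hEz : hE 𝕜 m n ξ • z = 0) {k : ℕ} (hk : k ≤ r) :
    ∃ Z ∈ Subalgebra.center 𝕜 (H 𝕜 m n ξ), (hd : H 𝕜 m n ξ) ^ k • hE 𝕜 m n ξ ^ (k + 1) • p
      = Z • hE 𝕜 m n ξ • p ∧ ∃ κ : 𝕜, κ ≠ 0 ∧ Z • z = κ • z := by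
  have hq := isPrimitiveRoot_q hm hn hξ
  have hq0 := pow_ne_zero m (root_ne_zero hm hn hξ)
  have hq1 : 1 - ξ ^ m ≠ 0 := sub_ne_zero.2 (q_ne_one hm hn hξ).symm
  set χ := β + ξ ^ m * γ ^ m with hχ
  have hKc := casimir_mem_center hm hn hξ χ
  have hKz : casimir 𝕜 m n ξ χ • z = 0 := by
    rw [hz.casimir_smul, hEz, smul_zero, sub_self, mul_zero, zero_smul, add_zero]
  induction k with
  | zero => exact ⟨1, one_mem _, by simp, 1, one_ne_zero, by simp⟩
  | succ k ih =>
    obtain ⟨Z, hZ, hZp, κ, hκ, hZz⟩ := ih (by omega)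
    have hw := hp.pow_E hm hn hξ (k + 1)
    set ψ := (1 - ξ ^ m)⁻¹ * ((ξ ^ m)⁻¹ ^ (k + 1) * β + ξ ^ m * (ξ ^ (k + 1) * γ) ^ m - χ) with hψ
    have hψ0 : ψ ≠ 0 := by
      have h1 : ψ = -(1 - ξ ^ m)⁻¹ * β * (1 - (ξ ^ m)⁻¹ ^ (k + 1))
          * (1 - (ξ ^ m) ^ (s + 1 + (k + 1))) := by
        have : (ξ ^ m)⁻¹ ^ (k + 1) * (ξ ^ m) ^ (k + 1) = 1 := by
          rw [← mul_pow, inv_mul_cancel₀ hq0, one_pow]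
        rw [hψ, hχ, mul_pow, pow_right_comm ξ, hβγ]
        linear_combination (1 - ξ ^ m)⁻¹ * β * (ξ ^ m) ^ (s + 1) * this
      have h2 := hq.inv.pow_ne_one_of_pos_of_lt (l := k + 1) (by omega) (by omega)
      have h3 := hq.pow_ne_one_of_pos_of_lt (l := s + 1 + (k + 1)) (by omega) (by omega)
      rw [h1]
      exact mul_ne_zero (mul_ne_zero (mul_ne_zero (neg_ne_zero.2 (inv_ne_zero hq1)) hβ)
        (sub_ne_zero.2 h2.symm)) (sub_ne_zero.2 h3.symm)
    have hstep : (hd : H 𝕜 m n ξ) • hE 𝕜 m n ξ • hE 𝕜 m n ξ ^ (k + 1) • p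
        = (casimir 𝕜 m n ξ χ - algebraMap 𝕜 _ ψ) • hE 𝕜 m n ξ ^ (k + 1) • p := by
      rw [sub_smul, hw.casimir_smul, algebraMap_smul, add_sub_cancel_right]
    have hmem : casimir 𝕜 m n ξ χ - algebraMap 𝕜 _ ψ ∈ Subalgebra.center 𝕜 (H 𝕜 m n ξ) :=
      sub_mem hKc (Subalgebra.algebraMap_mem _ ψ)
    refine ⟨(casimir 𝕜 m n ξ χ - algebraMap 𝕜 _ ψ) * Z, mul_mem hmem hZ, ?_, -ψ * κ,
      mul_ne_zero (neg_ne_zero.2 hψ0) hκ, ?_⟩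
    · rw [pow_succ, mul_smul, pow_succ' (hE 𝕜 m n ξ), mul_smul, hstep, ← mul_smul,
        Subalgebra.mem_center_iff.1 hmem, mul_smul, hZp, mul_smul]
    · rw [mul_smul, hZz, smul_comm, sub_smul, hKz, algebraMap_smul, zero_sub, smul_neg, smul_smul,
        neg_mul, neg_smul, mul_comm]

end Casimir

section Cover

variable {𝕜 m n ξ} {M T : Type*} [AddCommGroup M] [Module 𝕜 M] [Module (H 𝕜 m n ξ) M]
  [IsScalarTower 𝕜 (H 𝕜 m n ξ) M] [AddCommGroup T] [Module 𝕜 T] [Module (H 𝕜 m n ξ) T]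
  [IsScalarTower 𝕜 (H 𝕜 m n ξ) T] [IsSimpleModule (H 𝕜 m n ξ) T]
  (hm : 1 < m) (hn : 1 < n) (hξ : IsPrimitiveRoot ξ (m * n)) {π : M →ₗ[H 𝕜 m n ξ] T}
  {β γ : 𝕜} {z : T}
include hm hn hξ

/-- A surjection onto a simple module of dimension `n` has a complement to its kernel. -/
theorem exists_isCompl_ker (hπ : Function.Surjective π) (hz : IsWt m n ξ β γ z)
    (hEz : hE 𝕜 m n ξ • z = 0) (htop : (hd : H 𝕜 m n ξ) ^ (n - 1) • z ≠ 0) :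
    ∃ N : Submodule (H 𝕜 m n ξ) M, IsCompl (LinearMap.ker π) N := by
  have hR := shiftedRel_gen (𝕜 := 𝕜) hm hn hξ
  have hz0 : z ≠ 0 := by
    rintro rfl
    exact htop (smul_zero _)
  obtain ⟨x₀, hx₀, rfl⟩ := exists_wt_lift hm hn hξ hπ hz0 hz
  have hF : ∀ k, n ≤ k → (hd : H 𝕜 m n ξ) ^ k = 0 := fun k hk => pow_eq_zero_of_le hk hR.FPow
  obtain ⟨κ, hκ, hκz⟩ := exists_pow_E_pow_F hm hn hξ hz hEz htop
    (by rw [hF _ (by omega), zero_smul])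
  set x := hE 𝕜 m n ξ ^ (n - 1) • (hd : H 𝕜 m n ξ) ^ (n - 1) • x₀ with hxdef
  have hπx : π x = κ • π x₀ := by rw [hxdef, map_smul, map_smul, hκz]
  have hEx : hE 𝕜 m n ξ • x = 0 := by
    rw [hxdef, ← mul_smul, ← pow_succ', Nat.sub_add_cancel hn.le, hE_pow hm hn hξ, zero_smul]
  have hx := (hx₀.pow_F hm hn hξ (n - 1)).pow_E hm hn hξ (n - 1)
  rw [← hxdef] at hx
  let S : Submodule 𝕜 M :=
    Submodule.span 𝕜 (Set.range fun i : Fin n => (hd : H 𝕜 m n ξ) ^ (i : ℕ) • x)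
  have hmem : ∀ i, (hd : H 𝕜 m n ξ) ^ i • x ∈ S := fun i => by
    by_cases hi : i < n
    · exact Submodule.subset_span ⟨⟨i, hi⟩, rfl⟩
    · rw [hF _ (by omega), zero_smul]; exact S.zero_mem
  have stable : ∀ a : H 𝕜 m n ξ, (∀ i, a • (hd : H 𝕜 m n ξ) ^ i • x ∈ S) →
      ∀ y ∈ S, a • y ∈ S := by
    intro a ha' y hy
    refine (Submodule.span_le (p := S.comap (Algebra.lsmul 𝕜 𝕜 M a))).2 ?_ hy
    rintro _ ⟨i, rfl⟩
    exact ha' i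
  let N : Submodule (H 𝕜 m n ξ) M := stableSubmodule S
    (stable _ fun i => by
      obtain _ | i := i
      · rw [pow_zero, one_smul, hEx]; exact S.zero_mem
      · rw [hx.E_pow_F hm hn hξ, hEx, smul_zero, zero_add]; exact S.smul_mem _ (hmem _))
    (stable _ fun i => by rw [(hx.pow_F hm hn hξ i).b]; exact S.smul_mem _ (hmem _))
    (stable _ fun i => by rw [(hx.pow_F hm hn hξ i).c]; exact S.smul_mem _ (hmem _))
    (stable _ fun i => by rw [← mul_smul, ← pow_succ']; exact hmem _)
  refine ⟨N, Submodule.disjoint_def.2 fun y hy hyN => ?_, ?_⟩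
  · obtain ⟨a, rfl⟩ := (Submodule.mem_span_range_iff_exists_fun 𝕜).1
      (show y ∈ S from hyN)
    suffices ha' : ∀ (k : ℕ) (hk : k < n), a ⟨k, hk⟩ = 0 from
      Finset.sum_eq_zero fun i _ => by rw [ha' i i.2, zero_smul]
    intro k
    induction k using Nat.strong_induction_on with
    | _ k ih =>
      intro hk
      have h := congrArg ((hd : H 𝕜 m n ξ) ^ (n - 1 - k) • ·) (LinearMap.mem_ker.1 hy)
      simp only [map_sum, smul_zero, Finset.smul_sum] at h
      rw [Finset.sum_eq_single ⟨k, hk⟩] at h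
      · rw [LinearMap.map_smul_of_tower, map_smul, hπx, smul_comm _ (a _),
          ← mul_smul _ _ (κ • _), ← pow_add, Nat.sub_add_cancel (by omega), smul_comm _ κ] at h
        simpa [hκ, htop] using h
      · rintro ⟨j, hj⟩ - hjk
        obtain hlt | hlt := lt_or_gt_of_ne (a := j) (b := k) (fun h => hjk (Fin.ext h))
        · rw [ih j hlt, zero_smul, map_zero, smul_zero]
        · rw [LinearMap.map_smul_of_tower, map_smul, smul_comm _ (a _),
            ← mul_smul _ _ (π x), ← pow_add, hF (n - 1 - k + j) (by omega), zero_smul, smul_zero]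
      · simp
  · have hco := LinearMap.isCoatom_ker_of_surjective hπ
    refine codisjoint_iff.2 (hco.2 _ (lt_of_le_of_ne le_sup_left fun h => ?_))
    have hxN : x ∈ N := show x ∈ S by simpa using hmem 0
    have : x ∈ LinearMap.ker π := h ▸ Submodule.mem_sup_right hxN
    rw [LinearMap.mem_ker, hπx] at this
    exact smul_ne_zero hκ hz0 this

omit hm hn hξ [IsSimpleModule (H 𝕜 m n ξ) T] in
theorem IsWt.smul_of_mem_center {x : M} (hx : IsWt m n ξ β γ x) {Z : H 𝕜 m n ξ}
    (hZ : Z ∈ Subalgebra.center 𝕜 (H 𝕜 m n ξ)) : IsWt m n ξ β γ (Z • x) := by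
  have hZ := Subalgebra.mem_center_iff.1 hZ
  constructor
  · rw [← mul_smul, hZ, mul_smul, hx.b, smul_comm]
  · rw [← mul_smul, hZ, mul_smul, hx.c, smul_comm]

/-- An indecomposable projective module with a simple quotient of dimension `s + 1 < n` is a
standard projective, so its submodule lattice has the diamond shape. -/
theorem exists_isDiamond_of_projective {P : Type} [AddCommGroup P] [Module 𝕜 P]
    [Module (H 𝕜 m n ξ) P] [IsScalarTower 𝕜 (H 𝕜 m n ξ) P] (hproj : Module.Projective (H 𝕜 m n ξ) P)
    (hindec : Indec 𝕜 m n ξ P) {π : P →ₗ[H 𝕜 m n ξ] T} (hπ : Function.Surjective π)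
    (hz : IsWt m n ξ β γ z) (hEz : hE 𝕜 m n ξ • z = 0) {s : ℕ} (hsn : s + 1 < n)
    (hs : (hd : H 𝕜 m n ξ) ^ s • z ≠ 0) (hs1 : (hd : H 𝕜 m n ξ) ^ (s + 1) • z = 0) :
    ∃ N₁ N₂ A B : Submodule (H 𝕜 m n ξ) P, IsDiamond N₁ N₂ A B := by
  have hq := isPrimitiveRoot_q hm hn hξ
  have h0 := root_ne_zero hm hn hξ
  have hq0 := pow_ne_zero m h0
  obtain ⟨r, hsr⟩ : ∃ r, n = s + r + 2 := ⟨n - s - 2, by omega⟩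
  have hz0 : z ≠ 0 := by
    rintro rfl
    exact hs (smul_zero _)
  have hγ := hz.c_root hz0
  have hcoef : coef (ξ ^ m) β (γ ^ m) s = 0 := by
    have h := hz.E_pow_F hm hn hξ s
    rw [hs1, hEz, smul_zero, smul_zero, zero_add] at h
    exact (smul_eq_zero.1 h.symm).resolve_right hs
  have hβγ : γ ^ m = (ξ ^ m) ^ s * β := by
    by_contra h
    refine coef_ne_zero hq hsn (fun h' => h ?_) hcoef
    rw [h', ← mul_assoc, ← mul_pow, mul_inv_cancel₀ hq0, one_pow, one_mul]
  have hβn : β ^ n = 1 := by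
    have h : (γ ^ m) ^ n = 1 := by rw [← pow_mul, hγ]
    rwa [hβγ, mul_pow, pow_right_comm, hq.pow_eq_one, one_pow, one_mul] at h
  have hβ : β ≠ 0 := by
    rintro rfl
    rw [zero_pow (by omega)] at hβn
    exact zero_ne_one hβn
  obtain ⟨x₀, hx₀, hπx₀⟩ := exists_wt_lift hm hn hξ hπ hz0 hz
  obtain ⟨κ, hκ, hκz⟩ := exists_pow_E_pow_F hm hn hξ hz hEz hs hs1
  set p := hE 𝕜 m n ξ ^ s • (hd : H 𝕜 m n ξ) ^ s • x₀ with hpdef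
  have hp : IsWt m n ξ β γ p := by
    have := (hx₀.pow_F hm hn hξ s).pow_E hm hn hξ s
    rwa [← mul_assoc, ← mul_pow, inv_mul_cancel₀ hq0, ← mul_assoc, ← mul_pow, mul_inv_cancel₀ h0,
      one_pow, one_mul, one_mul] at this
  have hπp : π p = κ • z := by rw [hpdef, map_smul, map_smul, hπx₀, hκz]
  obtain ⟨Z, hZ, hZp, κ', hκ', hZz⟩ :=
    exists_central_pow_F_pow_E hm hn hξ hsr hβ hβγ hp hz hEz (le_refl r)
  have hu := hp.pow_E hm hn hξ (r + 1)
  have hqs : (ξ ^ m)⁻¹ ^ (r + 1) = (ξ ^ m) ^ (s + 1) := by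
    rw [inv_pow, inv_eq_iff_eq_inv]
    refine eq_inv_of_mul_eq_one_left ?_
    rw [← pow_add, show r + 1 + (s + 1) = n by omega, hq.pow_eq_one]
  rw [hqs] at hu
  obtain ⟨_, _, hB⟩ := exists_isModel hm hn hξ hsr hβn hγ hβγ (Pi.basisFun 𝕜 (Fin n ⊕ Fin n))
  obtain ⟨g, hg⟩ := hB.exists_hom hm hn hξ hsr hβγ (hp.smul_of_mem_center hZ) hu
    (by rw [hZp, ← mul_smul _ Z, ← mul_smul Z, Subalgebra.mem_center_iff.1 hZ])
    (by
      rw [hpdef, ← mul_smul, ← mul_smul, ← pow_succ', ← pow_add, show r + 1 + 1 + s = n by omega,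
        hE_pow hm hn hξ, zero_smul])
  obtain ⟨h, hh⟩ := hB.exists_hom hm hn hξ hsr hβγ hz
    (u := 0) ⟨by simp, by simp⟩ (by rw [hEz, smul_zero]) (smul_zero _)
  have hsurj : Function.Surjective h := LinearMap.surjective_of_ne_zero fun h' =>
    hz0 (by rw [← hh, h', LinearMap.zero_apply])
  obtain ⟨f, hf⟩ := Module.projective_lifting_property h π hsurj
  have hD := hB.isDiamond hm hn hξ hsr hβ hγ
  have hfg : Function.Surjective (f ∘ₗ g) := by
    refine surjective_of_comp_ne_zero hD.ne_top hD.le_of_ne_top (h := h) fun h' => ?_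
    have := LinearMap.congr_fun h' (vecL (Pi.basisFun 𝕜 (Fin n ⊕ Fin n)) 0)
    rw [← LinearMap.comp_assoc, hf, LinearMap.comp_apply, hg, map_smul, hπp, smul_comm, hZz,
      LinearMap.zero_apply] at this
    exact smul_ne_zero hκ (smul_ne_zero hκ' hz0) this
  have hbij : Function.Bijective (f ∘ₗ g) :=
    ⟨(LinearMap.injective_iff_surjective (f := (f ∘ₗ g).restrictScalars 𝕜)).2 hfg, hfg⟩
  have hfsurj : Function.Surjective f := .of_comp hfg
  have hker : LinearMap.ker f = ⊥ := by
    refine (hindec.2 _ _ (isCompl_ker_range_of_bijective hbij)).resolve_right fun h' => ?_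
    rw [LinearMap.range_eq_bot] at h'
    rw [h', LinearMap.comp_zero] at hfg
    obtain ⟨x, hx⟩ := hsurj z
    obtain ⟨y, rfl⟩ := hfg x
    exact hz0 (by rw [← hx, LinearMap.zero_apply]; exact map_zero h)
  exact ⟨_, _, _, _, hD.map (Submodule.orderIsoMapComap
    (LinearEquiv.ofBijective f ⟨LinearMap.ker_eq_bot.1 hker, hfsurj⟩).symm)⟩

end Cover

/-- Corollary 3.11: if `P` is a non-simple finite dimensional
indecomposable projective `H_{mn}(ξ)`-module, then `rad P = soc² P` and `rad² P = soc P`. -/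
theorem statement10 (𝕜 : Type) [Field 𝕜] [IsAlgClosed 𝕜] (m n : ℕ) (hm : 1 < m) (hn : 1 < n)
    (ξ : 𝕜) (hξ : IsPrimitiveRoot ξ (m * n))
    (P : Type) [AddCommGroup P] [Module 𝕜 P] [Module (H 𝕜 m n ξ) P]
    [IsScalarTower 𝕜 (H 𝕜 m n ξ) P] [FiniteDimensional 𝕜 P]
    (hproj : Module.Projective (H 𝕜 m n ξ) P) (hindec : Indec 𝕜 m n ξ P)
    (hns : ¬ IsSimpleModule (H 𝕜 m n ξ) P) :
    radM 𝕜 m n ξ P =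
      Submodule.comap (socle 𝕜 m n ξ P).mkQ (socle 𝕜 m n ξ (P ⧸ socle 𝕜 m n ξ P)) ∧
    rad2M 𝕜 m n ξ P = socle 𝕜 m n ξ P := by
  have := isArtinianRing_H hm hn hξ
  have : Module.Finite (H 𝕜 m n ξ) P := Module.Finite.of_restrictScalars_finite 𝕜 _ _
  have := hindec.1
  obtain ⟨N, hN, -⟩ := (eq_top_or_exists_le_coatom (⊥ : Submodule (H 𝕜 m n ξ) P)).resolve_left
    bot_ne_top
  have : IsSimpleModule (H 𝕜 m n ξ) (P ⧸ N) := isSimpleModule_iff_isCoatom.2 hN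
  have : Nontrivial (P ⧸ N) := IsSimpleModule.nontrivial (H 𝕜 m n ξ) _
  have hπ := N.mkQ_surjective
  obtain ⟨β, γ, z, hz0, hz, hEz⟩ := exists_highestWeight (P ⧸ N) hm hn hξ
  by_cases htop : (gen 𝕜 m n ξ 3) ^ (n - 1) • z = 0
  · have hex : ∃ k, (gen 𝕜 m n ξ 3) ^ k • z = 0 := ⟨_, htop⟩
    obtain ⟨s, hs, hs1, hmin⟩ : ∃ s, s + 1 < n ∧ (gen 𝕜 m n ξ 3) ^ (s + 1) • z = 0 ∧
        (gen 𝕜 m n ξ 3) ^ s • z ≠ 0 := by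
      classical
      obtain ⟨s, hs⟩ : ∃ s, Nat.find hex = s + 1 :=
        Nat.exists_eq_succ_of_ne_zero fun h => hz0 (by simpa [h] using Nat.find_spec hex)
      refine ⟨s, ?_, hs ▸ Nat.find_spec hex, Nat.find_min hex (by omega)⟩
      have := Nat.find_min' hex htop
      omega
    obtain ⟨_, _, _, _, hD⟩ :=
      exists_isDiamond_of_projective hm hn hξ hproj hindec hπ hz hEz hs hmin hs1
    exact radical_socle_of_isDiamond hD
  · obtain ⟨N', hN'⟩ := exists_isCompl_ker hm hn hξ hπ hz hEz htop
    rw [N.ker_mkQ] at hN'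
    obtain rfl | rfl := hindec.2 _ _ hN'
    · exact absurd (IsSimpleModule.congr (Submodule.quotEquivOfEqBot _ rfl).symm) hns
    · exact absurd (eq_top_of_isCompl_bot hN') hN.1

end Radford
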